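/- arXiv:1010.5184 — 4 statements merged into one kernel-verified Lean document; each statement's English description precedes it below -/
import Mathlib

section
/- Hankel inversion formula: let ν ∈ ℂ with Re(ν) > −1 and let f ∈ S_ν([0,∞)). Then H_ν(H_ν(f))(y) = f(y) for all y > 0. -/
open MeasureTheory Set

/-- The classical J-Bessel function of complex index `ν`, via its power series
(principal branch of powers). -/
noncomputable def besselJ (ν : ℂ) (x : ℝ) : ℂ :=
  ∑' k : ℕ, ((-1 : ℂ) ^ k * ((x / 2 : ℝ) : ℂ) ^ (ν + 2 * (k : ℂ))) /
    (Complex.Gamma ((k : ℂ) + 1) * Complex.Gamma ((k : ℂ) + ν + 1))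

/-- `g` and all of its derivatives are rapidly decreasing at `+∞`. -/
def RapidlyDecreasing (g : ℝ → ℂ) : Prop :=
  ∀ m n : ℕ, ∃ C : ℝ, ∀ x : ℝ, 1 ≤ x → x ^ m * ‖iteratedDeriv n g x‖ ≤ C

/-- Membership in the Schwartz space `S([0,∞))`: `f` agrees on `[0,∞)` with a smooth
function on `ℝ` all of whose derivatives are rapidly decreasing at `+∞`. -/
def MemSHalf (f : ℝ → ℂ) : Prop :=
  ∃ g : ℝ → ℂ, ContDiff ℝ (⊤ : ℕ∞) g ∧ (∀ x : ℝ, 0 ≤ x → f x = g x) ∧ RapidlyDecreasing g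

/-- Membership in `S_ν([0,∞))`: `f(x) = x^{(ν+1)/2} f₁(x)` on `[0,∞)` for some
`f₁ ∈ S([0,∞))` (principal branch of the complex power). -/
def MemSnu (ν : ℂ) (f : ℝ → ℂ) : Prop :=
  ∃ f₁ : ℝ → ℂ, MemSHalf f₁ ∧ ∀ x : ℝ, 0 ≤ x → f x = (x : ℂ) ^ ((ν + 1) / 2) * f₁ x

/-- The Hankel transform of order `ν`: `H_ν(f)(y) = ∫₀^∞ f(x) √(xy) J_ν(2√(xy)) dx/x`. -/
noncomputable def hankel (ν : ℂ) (f : ℝ → ℂ) (y : ℝ) : ℂ :=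
  ∫ x in Ioi (0 : ℝ), f x * (Real.sqrt (x * y) : ℂ) * besselJ ν (2 * Real.sqrt (x * y)) / (x : ℂ)

/-- The coefficient `1 / Γ(k + μ + 1)` of the normalised Bessel series. -/
noncomputable def besselCoeff (μ : ℂ) (k : ℕ) : ℂ := (Complex.Gamma ((k : ℂ) + μ + 1))⁻¹

/-- The normalised Bessel function `u ^ (-μ / 2) * J_μ (2 √u)`, as an entire power series. -/
noncomputable def besselE (μ : ℂ) (u : ℝ) : ℂ :=
  ∑' k : ℕ, (-1 : ℂ) ^ k * besselCoeff μ k * (((u ^ k / k.factorial : ℝ)) : ℂ)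

lemma besselCoeff_succ_index {μ : ℂ} (k : ℕ) :
    besselCoeff (μ + 1) k = besselCoeff μ (k + 1) := by
  unfold besselCoeff
  congr 2
  push_cast
  ring

lemma besselCoeff_eq {μ : ℂ} (hμ : -1 < μ.re) (k : ℕ) :
    besselCoeff μ k = ((k : ℂ) + μ + 1) * besselCoeff (μ + 1) k := by
  have h0 : (k : ℂ) + μ + 1 ≠ 0 := by
    intro h
    have := congrArg Complex.re h
    simp at this
    have : (0 : ℝ) ≤ k := k.cast_nonneg
    linarith
  unfold besselCoeff
  rw [← add_assoc, Complex.Gamma_add_one _ h0]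
  have hG : Complex.Gamma ((k : ℂ) + μ + 1) ≠ 0 := by
    apply Complex.Gamma_ne_zero_of_re_pos
    have : (0 : ℝ) ≤ k := k.cast_nonneg
    simp
    linarith
  field_simp

lemma norm_besselCoeff_mul_Gamma_le {μ : ℂ} (hμ : -1 < μ.re) (k : ℕ) :
    ‖besselCoeff μ k‖ * Real.Gamma (k + μ.re + 1) ≤
      ‖besselCoeff μ 0‖ * Real.Gamma (μ.re + 1) := by
  induction k with
  | zero => simp
  | succ k ih =>
    refine le_trans ?_ ih
    have hk : (0 : ℝ) ≤ k := k.cast_nonneg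
    rw [besselCoeff_eq hμ k, besselCoeff_succ_index]
    have : ((k + 1 : ℕ) : ℝ) + μ.re + 1 = (k + μ.re + 1) + 1 := by push_cast; ring
    rw [this, Real.Gamma_add_one (by linarith), norm_mul]
    have hle : (k : ℝ) + μ.re + 1 ≤ ‖(k : ℂ) + μ + 1‖ := by
      simpa using Complex.re_le_norm ((k : ℂ) + μ + 1)
    have hG : 0 ≤ Real.Gamma (k + μ.re + 1) := Real.Gamma_nonneg_of_nonneg (by linarith)
    calc _ = ((k : ℝ) + μ.re + 1) * (‖besselCoeff μ (k + 1)‖ * Real.Gamma (k + μ.re + 1)) := by ring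
      _ ≤ ‖(k : ℂ) + μ + 1‖ * (‖besselCoeff μ (k + 1)‖ * Real.Gamma (k + μ.re + 1)) := by gcongr
      _ = _ := by ring

lemma exists_norm_besselCoeff_le {μ : ℂ} (hμ : -1 < μ.re) :
    ∃ C : ℝ, 0 ≤ C ∧ ∀ k, ‖besselCoeff μ k‖ ≤ C := by
  refine ⟨max ‖besselCoeff μ 0‖ ‖besselCoeff μ 1‖, by positivity, fun k => ?_⟩
  rcases k with _ | k
  · exact le_max_left _ _
  refine le_trans ?_ (le_max_right _ _)
  induction k with
  | zero => simp
  | succ k ih =>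
    refine le_trans ?_ ih
    rw [besselCoeff_eq hμ (k + 1), besselCoeff_succ_index, norm_mul]
    have hk : (0 : ℝ) ≤ k := k.cast_nonneg
    have hle : 1 ≤ ‖((k + 1 : ℕ) : ℂ) + μ + 1‖ := by
      refine le_trans ?_ (Complex.re_le_norm _)
      simp
      linarith
    exact le_mul_of_one_le_left (norm_nonneg _) hle

lemma summable_besselE {μ : ℂ} (hμ : -1 < μ.re) (u : ℝ) :
    Summable fun k : ℕ => (-1 : ℂ) ^ k * besselCoeff μ k * (((u ^ k / k.factorial : ℝ)) : ℂ) := by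
  obtain ⟨C, hC, h⟩ := exists_norm_besselCoeff_le hμ
  refine Summable.of_norm_bounded ((Real.summable_pow_div_factorial |u|).mul_left C) fun k => ?_
  rw [norm_mul, norm_mul, norm_pow, norm_neg, norm_one, one_pow, one_mul, Complex.norm_real,
    Real.norm_eq_abs, abs_div, abs_pow, Nat.abs_cast]
  gcongr
  exact h k

lemma hasDerivAt_pow_div_factorial (k : ℕ) (u : ℝ) :
    HasDerivAt (fun u : ℝ => (((u ^ (k + 1) / (k + 1).factorial : ℝ)) : ℂ))
      (((u ^ k / k.factorial : ℝ)) : ℂ) u := by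
  refine HasDerivAt.ofReal_comp ?_
  convert! (hasDerivAt_pow (k + 1) u).div_const ((k + 1).factorial : ℝ) using 1
  rw [Nat.factorial_succ]
  have : (k.factorial : ℝ) ≠ 0 := by positivity
  push_cast
  field_simp

lemma hasDerivAt_besselE {μ : ℂ} (hμ : -1 < μ.re) (u : ℝ) :
    HasDerivAt (besselE μ) (-besselE (μ + 1) u) u := by
  have hμ1 : -1 < (μ + 1).re := by simp; linarith
  obtain ⟨C, hC, h⟩ := exists_norm_besselCoeff_le hμ1
  have hsplit : besselE μ = fun u : ℝ => besselCoeff μ 0 +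
      ∑' k : ℕ, (-1 : ℂ) ^ (k + 1) * besselCoeff μ (k + 1) *
        (((u ^ (k + 1) / (k + 1).factorial : ℝ)) : ℂ) := by
    funext v
    unfold besselE
    rw [(summable_besselE hμ v).tsum_eq_zero_add]
    simp
  rw [hsplit]
  refine HasDerivAt.const_add _ ?_
  have hneg : -besselE (μ + 1) u = ∑' k : ℕ, (-1 : ℂ) ^ (k + 1) * besselCoeff μ (k + 1) *
      (((u ^ k / k.factorial : ℝ)) : ℂ) := by
    unfold besselE
    rw [← tsum_neg]
    refine tsum_congr fun k => ?_
    rw [besselCoeff_succ_index]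
    ring
  rw [hneg]
  refine hasDerivAt_tsum_of_isPreconnected
    (g := fun k (v : ℝ) => (-1 : ℂ) ^ (k + 1) * besselCoeff μ (k + 1) *
        (((v ^ (k + 1) / (k + 1).factorial : ℝ)) : ℂ))
    (g' := fun k (v : ℝ) => (-1 : ℂ) ^ (k + 1) * besselCoeff μ (k + 1) *
        (((v ^ k / k.factorial : ℝ)) : ℂ))
    (u := fun k => C * ((|u| + 1) ^ k / k.factorial)) (t := Metric.ball 0 (|u| + 1)) (y₀ := u)
    ((Real.summable_pow_div_factorial _).mul_left C) Metric.isOpen_ball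
    (convex_ball _ _).isPreconnected (fun k v _ => (hasDerivAt_pow_div_factorial k v).const_mul _)
    (fun k v hv => ?_) (by simp) ?_ (by simp)
  · rw [norm_mul, norm_mul, norm_pow, norm_neg, norm_one, one_pow, one_mul, Complex.norm_real,
      Real.norm_eq_abs, abs_div, abs_pow, Nat.abs_cast]
    have hv' : |v| ≤ |u| + 1 := by
      have := (mem_ball_zero_iff.mp hv).le
      simpa using this
    gcongr
    rw [← besselCoeff_succ_index]
    exact h k
  · exact (summable_nat_add_iff (f := fun k : ℕ => (-1 : ℂ) ^ k * besselCoeff μ k *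
      (((u ^ k / k.factorial : ℝ)) : ℂ)) 1).2 (summable_besselE hμ u)

lemma besselE_eq {μ : ℂ} (hμ : -1 < μ.re) (u : ℝ) :
    besselE μ u = (μ + 1) * besselE (μ + 1) u - u * besselE (μ + 2) u := by
  have hμ1 : -1 < (μ + 1).re := by simp; linarith
  have hμ2 : -1 < (μ + 2).re := by simp; linarith
  have hs := summable_besselE hμ1 u
  have hs2 : Summable fun k : ℕ => (-1 : ℂ) ^ k * k * besselCoeff (μ + 1) k *
      (((u ^ k / k.factorial : ℝ)) : ℂ) := by
    refine ((summable_besselE hμ u).sub (hs.mul_left (μ + 1))).congr fun k => ?_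
    rw [besselCoeff_eq hμ]
    ring
  have hshift : ∑' k : ℕ, (-1 : ℂ) ^ k * k * besselCoeff (μ + 1) k *
      (((u ^ k / k.factorial : ℝ)) : ℂ) = -(u * besselE (μ + 2) u) := by
    rw [hs2.tsum_eq_zero_add]
    unfold besselE
    rw [← tsum_mul_left, ← tsum_neg]
    simp only [Nat.cast_zero, mul_zero, zero_mul, zero_add]
    refine tsum_congr fun k => ?_
    rw [← besselCoeff_succ_index, show μ + 1 + 1 = μ + 2 by ring, Nat.factorial_succ]
    have : (k.factorial : ℂ) ≠ 0 := by exact_mod_cast k.factorial_ne_zero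
    have : (k : ℂ) + 1 ≠ 0 := by exact_mod_cast k.succ_ne_zero
    push_cast
    field_simp
    ring
  rw [sub_eq_add_neg, ← hshift]
  unfold besselE
  rw [← tsum_mul_left, ← (hs.mul_left _).tsum_add hs2]
  refine tsum_congr fun k => ?_
  rw [besselCoeff_eq hμ]
  ring

lemma continuous_besselE {μ : ℂ} (hμ : -1 < μ.re) : Continuous (besselE μ) :=
  continuous_iff_continuousAt.2 fun u => (hasDerivAt_besselE hμ u).continuousAt

lemma exists_norm_besselE_le {μ : ℂ} (hμ : 0 ≤ μ.re) :
    ∃ C : ℝ, ∀ u : ℝ, 0 ≤ u → ‖besselE μ u‖ ≤ C := by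
  have hμ0 : -1 < μ.re := by linarith
  have hμ1 : -1 < (μ + 1).re := by simp; linarith
  have hd (u : ℝ) := ((hasDerivAt_besselE hμ0 u).norm_sq).add
    ((hasDerivAt_id u).mul (hasDerivAt_besselE hμ1 u).norm_sq)
  have hanti : AntitoneOn ((fun u => ‖besselE μ u‖ ^ 2) +
      id * fun u => ‖besselE (μ + 1) u‖ ^ 2) (Ici 0) := by
    refine antitoneOn_of_deriv_nonpos (convex_Ici 0)
      (fun u _ => (hd u).continuousAt.continuousWithinAt)
      (fun u _ => (hd u).differentiableAt.differentiableWithinAt) fun u hu => ?_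
    rw [(hd u).deriv]
    have hr := besselE_eq hμ0 u
    rw [show μ + 1 + 1 = μ + 2 by ring]
    have hr' : u * besselE (μ + 2) u = (μ + 1) * besselE (μ + 1) u - besselE μ u := by
      rw [hr]; ring
    have hin : u * inner ℝ (besselE (μ + 1) u) (-besselE (μ + 2) u) =
        inner ℝ (besselE (μ + 1) u) (besselE μ u) - (μ.re + 1) * ‖besselE (μ + 1) u‖ ^ 2 := by
      have : u * inner ℝ (besselE (μ + 1) u) (-besselE (μ + 2) u) =
          -inner ℝ (besselE (μ + 1) u) (u * besselE (μ + 2) u) := by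
        simp [Complex.inner]
        ring
      rw [this, hr', ← Complex.normSq_eq_norm_sq]
      simp [Complex.inner, Complex.normSq_apply]
      ring
    have hcomm : inner ℝ (besselE μ u) (-besselE (μ + 1) u) =
        -inner ℝ (besselE (μ + 1) u) (besselE μ u) := by
      rw [inner_neg_right, real_inner_comm]
    have : 0 ≤ μ.re * ‖besselE (μ + 1) u‖ ^ 2 := by positivity
    have : 0 ≤ ‖besselE (μ + 1) u‖ ^ 2 := by positivity
    simp only [id]
    rw [hcomm]
    nlinarith
  refine ⟨‖besselE μ 0‖, fun u hu => ?_⟩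
  have := hanti (mem_Ici.2 le_rfl) (mem_Ici.2 hu) hu
  simp only [Pi.add_apply, Pi.mul_apply, id, zero_mul, add_zero] at this
  refine le_of_sq_le_sq ?_ (norm_nonneg _)
  have h2 : 0 ≤ u * ‖besselE (μ + 1) u‖ ^ 2 := by positivity
  linarith

lemma exists_pow_mul_norm_besselE_le (m : ℕ) {μ : ℂ} (hμ : 2 * m ≤ μ.re) :
    ∃ C : ℝ, ∀ u : ℝ, 0 ≤ u → u ^ m * ‖besselE μ u‖ ≤ C := by
  induction m generalizing μ with
  | zero => simpa using exists_norm_besselE_le (by simpa using hμ)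
  | succ m ih =>
    push_cast at hμ
    have hm : (0 : ℝ) ≤ m := m.cast_nonneg
    obtain ⟨C₁, h₁⟩ := ih (μ := μ - 1) (by simp; linarith)
    obtain ⟨C₂, h₂⟩ := ih (μ := μ - 2) (by simp; linarith)
    refine ⟨‖μ - 1‖ * C₁ + C₂, fun u hu => ?_⟩
    have hr := besselE_eq (μ := μ - 2) (by simp; linarith) u
    rw [show μ - 2 + 1 = μ - 1 by ring, sub_add_cancel] at hr
    have hr' : u * besselE μ u = (μ - 1) * besselE (μ - 1) u - besselE (μ - 2) u := by
      rw [hr]; ring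
    have hn : u * ‖besselE μ u‖ ≤ ‖μ - 1‖ * ‖besselE (μ - 1) u‖ + ‖besselE (μ - 2) u‖ := by
      have := norm_sub_le ((μ - 1) * besselE (μ - 1) u) (besselE (μ - 2) u)
      rw [← hr', norm_mul, norm_mul, Complex.norm_real, Real.norm_of_nonneg hu] at this
      exact this
    calc u ^ (m + 1) * ‖besselE μ u‖ = u ^ m * (u * ‖besselE μ u‖) := by ring
      _ ≤ u ^ m * (‖μ - 1‖ * ‖besselE (μ - 1) u‖ + ‖besselE (μ - 2) u‖) := by gcongr
      _ = ‖μ - 1‖ * (u ^ m * ‖besselE (μ - 1) u‖) + u ^ m * ‖besselE (μ - 2) u‖ := by ring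
      _ ≤ _ := by gcongr; exacts [h₁ u hu, h₂ u hu]

lemma exists_norm_besselE_le_one_add {μ : ℂ} (hμ : -1 < μ.re) :
    ∃ C : ℝ, 0 ≤ C ∧ ∀ u : ℝ, 0 ≤ u → ‖besselE μ u‖ ≤ C * (1 + u) := by
  obtain ⟨C₁, h₁⟩ := exists_norm_besselE_le (μ := μ + 1) (by simp; linarith)
  obtain ⟨C₂, h₂⟩ := exists_norm_besselE_le (μ := μ + 2) (by simp; linarith)
  have hC₁ : 0 ≤ C₁ := (norm_nonneg _).trans (h₁ 0 le_rfl)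
  have hC₂ : 0 ≤ C₂ := (norm_nonneg _).trans (h₂ 0 le_rfl)
  refine ⟨‖μ + 1‖ * C₁ + C₂, by positivity, fun u hu => ?_⟩
  rw [besselE_eq hμ u]
  refine (norm_sub_le _ _).trans ?_
  rw [norm_mul, norm_mul, Complex.norm_real, Real.norm_of_nonneg hu]
  have : ‖μ + 1‖ * ‖besselE (μ + 1) u‖ ≤ ‖μ + 1‖ * C₁ := by gcongr; exact h₁ u hu
  have : u * ‖besselE (μ + 2) u‖ ≤ u * C₂ := by gcongr; exact h₂ u hu
  have : 0 ≤ ‖μ + 1‖ * C₁ * u := by positivity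
  nlinarith

/-- Absolute integrability of `h` on `(0, ∞)` against the weight `x ^ μ * (1 + x)`. -/
def WeightIntegrable (μ : ℂ) (h : ℝ → ℂ) : Prop :=
  IntegrableOn (fun x : ℝ => (x : ℂ) ^ μ * h x * ((1 + x : ℝ) : ℂ)) (Ioi 0)

/-- The Hankel transform in its entire normalisation: integration against
`x ^ μ * besselE μ (x * y)`. -/
noncomputable def besselT (μ : ℂ) (h : ℝ → ℂ) (y : ℝ) : ℂ :=
  ∫ x in Ioi (0 : ℝ), (x : ℂ) ^ μ * h x * besselE μ (x * y)

lemma continuousOn_ofReal_cpow (μ : ℂ) : ContinuousOn (fun x : ℝ => (x : ℂ) ^ μ) (Ioi 0) :=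
  fun x hx => (Complex.continuousAt_ofReal_cpow_const x μ (Or.inr (ne_of_gt hx))).continuousWithinAt

lemma WeightIntegrable.of_bounds {μ : ℂ} (hμ : -1 < μ.re) {h : ℝ → ℂ}
    (hc : ContinuousOn h (Ioi 0)) {C₀ C₁ : ℝ} {m : ℕ} (hm : μ.re + 2 < m)
    (h₀ : ∀ x : ℝ, 0 < x → x ≤ 1 → ‖h x‖ ≤ C₀)
    (h₁ : ∀ x : ℝ, 1 ≤ x → x ^ m * ‖h x‖ ≤ C₁) : WeightIntegrable μ h := by
  have hcont : ContinuousOn (fun x : ℝ => (x : ℂ) ^ μ * h x * ((1 + x : ℝ) : ℂ)) (Ioi 0) :=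
    ((continuousOn_ofReal_cpow μ).mul hc).mul (by fun_prop)
  have hnorm (x : ℝ) (hx : 0 < x) : ‖(x : ℂ) ^ μ * h x * ((1 + x : ℝ) : ℂ)‖ =
      x ^ μ.re * ‖h x‖ * (1 + x) := by
    rw [norm_mul, norm_mul, Complex.norm_cpow_eq_rpow_re_of_pos hx, Complex.norm_real,
      Real.norm_of_nonneg (by linarith)]
  unfold WeightIntegrable
  rw [← Ioc_union_Ioi_eq_Ioi (zero_le_one' ℝ)]
  refine IntegrableOn.union ?_ ?_
  · have hi : IntegrableOn (fun x : ℝ => C₀ * 2 * x ^ μ.re) (Ioc 0 1) :=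
      ((intervalIntegrable_iff_integrableOn_Ioc_of_le zero_le_one).1
        (intervalIntegral.intervalIntegrable_rpow' hμ)).const_mul _
    refine Integrable.mono' hi
      ((hcont.mono Ioc_subset_Ioi_self).aestronglyMeasurable measurableSet_Ioc) ?_
    refine (ae_restrict_iff' measurableSet_Ioc).2 (.of_forall fun x hx => ?_)
    rw [hnorm x hx.1]
    have hp : 0 ≤ x ^ μ.re := Real.rpow_nonneg hx.1.le _
    have hC := h₀ x hx.1 hx.2
    have hC' : 0 ≤ C₀ := (norm_nonneg _).trans hC
    calc x ^ μ.re * ‖h x‖ * (1 + x) ≤ x ^ μ.re * C₀ * 2 := by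
          gcongr
          · have := hx.1; linarith
          · have := hx.2; linarith
      _ = _ := by ring
  · have hi : IntegrableOn (fun x : ℝ => C₁ * 2 * x ^ (μ.re + 1 - m)) (Ioi 1) :=
      (integrableOn_Ioi_rpow_of_lt (by linarith) zero_lt_one).const_mul _
    refine Integrable.mono' hi
      ((hcont.mono (Ioi_subset_Ioi zero_le_one)).aestronglyMeasurable measurableSet_Ioi) ?_
    refine (ae_restrict_iff' measurableSet_Ioi).2 (.of_forall fun x hx => ?_)
    have hx1 : 1 < x := hx
    have hx0 : 0 < x := by linarith
    rw [hnorm x hx0, Real.rpow_sub hx0, Real.rpow_add hx0, Real.rpow_one, Real.rpow_natCast]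
    have hp : 0 ≤ x ^ μ.re := Real.rpow_nonneg hx0.le _
    have hxm : 0 < x ^ m := by positivity
    have hb : ‖h x‖ ≤ C₁ / x ^ m := by
      rw [le_div_iff₀ hxm, mul_comm]
      exact h₁ x hx1.le
    have hC : 0 ≤ C₁ / x ^ m := (norm_nonneg _).trans hb
    calc x ^ μ.re * ‖h x‖ * (1 + x) ≤ x ^ μ.re * (C₁ / x ^ m) * (2 * x) := by
          gcongr
          linarith
      _ = _ := by ring

lemma exists_norm_besselE_div_le {μ : ℂ} (hμ : -1 < μ.re) :
    ∃ C : ℝ, 0 ≤ C ∧ ∀ x y : ℝ, 0 < x → 0 ≤ y →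
      ‖besselE μ (x * y) / ((1 + x : ℝ) : ℂ)‖ ≤ C * (1 + y) := by
  obtain ⟨C, hC, h⟩ := exists_norm_besselE_le_one_add hμ
  refine ⟨C, hC, fun x y hx hy => ?_⟩
  rw [norm_div, Complex.norm_real, Real.norm_of_nonneg (by linarith), div_le_iff₀ (by linarith)]
  refine (h _ (by positivity)).trans ?_
  rw [mul_assoc]
  gcongr
  nlinarith

lemma weighted_mul_besselE_eq (μ : ℂ) (h : ℝ → ℂ) (y : ℝ) {x : ℝ} (hx : 0 < x) :
    besselE μ (x * y) / ((1 + x : ℝ) : ℂ) * ((x : ℂ) ^ μ * h x * ((1 + x : ℝ) : ℂ)) =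
      (x : ℂ) ^ μ * h x * besselE μ (x * y) := by
  have : ((1 + x : ℝ) : ℂ) ≠ 0 := by
    rw [Complex.ofReal_ne_zero]; linarith
  field_simp

lemma continuousOn_besselE_div {μ : ℂ} (hμ : -1 < μ.re) (y : ℝ) :
    ContinuousOn (fun x : ℝ => besselE μ (x * y) / ((1 + x : ℝ) : ℂ)) (Ioi 0) := by
  refine ContinuousOn.div ((continuous_besselE hμ).comp (by fun_prop)).continuousOn
    (by fun_prop) fun x hx => ?_
  rw [Complex.ofReal_ne_zero]
  have : 0 < x := hx
  linarith

lemma WeightIntegrable.integrableOn_mul_besselE {μ : ℂ} (hμ : -1 < μ.re) {h : ℝ → ℂ}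
    (hh : WeightIntegrable μ h) {y : ℝ} (hy : 0 ≤ y) :
    IntegrableOn (fun x : ℝ => (x : ℂ) ^ μ * h x * besselE μ (x * y)) (Ioi 0) := by
  obtain ⟨C, hC, hK⟩ := exists_norm_besselE_div_le hμ
  refine (IntegrableOn.congr_fun (f := fun x : ℝ => besselE μ (x * y) / ((1 + x : ℝ) : ℂ) *
    ((x : ℂ) ^ μ * h x * ((1 + x : ℝ) : ℂ))) ?_
    (fun x hx => weighted_mul_besselE_eq μ h y hx) measurableSet_Ioi)
  refine Integrable.bdd_mul (c := C * (1 + y)) hh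
    ((continuousOn_besselE_div hμ y).aestronglyMeasurable measurableSet_Ioi) ?_
  exact (ae_restrict_iff' measurableSet_Ioi).2 (.of_forall fun x hx => hK x y hx hy)

lemma WeightIntegrable.norm_mul_besselE_le {μ : ℂ} {h : ℝ → ℂ} {C : ℝ}
    (hK : ∀ x y : ℝ, 0 < x → 0 ≤ y →
      ‖besselE μ (x * y) / ((1 + x : ℝ) : ℂ)‖ ≤ C * (1 + y)) {x y : ℝ} (hx : 0 < x) (hy : 0 ≤ y) :
    ‖(x : ℂ) ^ μ * h x * besselE μ (x * y)‖ ≤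
      C * (1 + y) * ‖(x : ℂ) ^ μ * h x * ((1 + x : ℝ) : ℂ)‖ := by
  rw [← weighted_mul_besselE_eq μ h y hx, norm_mul]
  gcongr
  exact hK x y hx hy

lemma WeightIntegrable.exists_norm_besselT_le {μ : ℂ} (hμ : -1 < μ.re) {h : ℝ → ℂ}
    (hh : WeightIntegrable μ h) : ∃ C : ℝ, ∀ y : ℝ, 0 ≤ y → ‖besselT μ h y‖ ≤ C * (1 + y) := by
  obtain ⟨C, hC, hK⟩ := exists_norm_besselE_div_le hμ
  refine ⟨C * ∫ x in Ioi (0 : ℝ), ‖(x : ℂ) ^ μ * h x * ((1 + x : ℝ) : ℂ)‖, fun y hy => ?_⟩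
  calc ‖besselT μ h y‖ ≤ ∫ x in Ioi (0 : ℝ),
        C * (1 + y) * ‖(x : ℂ) ^ μ * h x * ((1 + x : ℝ) : ℂ)‖ := by
        refine norm_integral_le_of_norm_le ((Integrable.norm hh).const_mul _) ?_
        exact (ae_restrict_iff' measurableSet_Ioi).2
          (.of_forall fun x hx => norm_mul_besselE_le hK hx hy)
    _ = _ := by rw [integral_const_mul]; ring

lemma WeightIntegrable.continuousOn_besselT {μ : ℂ} (hμ : -1 < μ.re) {h : ℝ → ℂ}
    (hh : WeightIntegrable μ h) : ContinuousOn (besselT μ h) (Ioi 0) := by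
  obtain ⟨C, hC, hK⟩ := exists_norm_besselE_div_le hμ
  intro y₀ hy₀
  have hy₀' : 0 < y₀ := hy₀
  have hcont : ContinuousOn (besselT μ h) (Ioo 0 (y₀ + 1)) := by
    refine continuousOn_of_dominated
      (bound := fun x : ℝ => C * (1 + (y₀ + 1)) * ‖(x : ℂ) ^ μ * h x * ((1 + x : ℝ) : ℂ)‖)
      (fun y hy => (hh.integrableOn_mul_besselE hμ hy.1.le).aestronglyMeasurable)
      (fun y hy => (ae_restrict_iff' measurableSet_Ioi).2 (.of_forall fun x hx => ?_))
      ((Integrable.norm hh).const_mul _) (.of_forall fun x => ?_)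
    · refine (norm_mul_besselE_le hK hx hy.1.le).trans ?_
      gcongr
      exact hy.2.le
    · exact (continuous_const.mul ((continuous_besselE hμ).comp (by fun_prop))).continuousOn
  exact (hcont.continuousAt (Ioo_mem_nhds hy₀' (by linarith))).continuousWithinAt

lemma integral_besselT_mul {μ : ℂ} (hμ : -1 < μ.re) {h k : ℝ → ℂ}
    (hh : WeightIntegrable μ h) (hk : WeightIntegrable μ k) :
    ∫ x in Ioi (0 : ℝ), (x : ℂ) ^ μ * besselT μ h x * k x =
      ∫ x in Ioi (0 : ℝ), (x : ℂ) ^ μ * h x * besselT μ k x := by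
  obtain ⟨C, hC, hK⟩ := exists_norm_besselE_div_le hμ
  let ρ : Measure ℝ := volume.restrict (Ioi 0)
  have hpos : ∀ᵐ z : ℝ × ℝ ∂(ρ.prod ρ), 0 < z.1 ∧ 0 < z.2 := by
    have : ρ.prod ρ = volume.restrict (Ioi (0 : ℝ) ×ˢ Ioi (0 : ℝ)) := by
      rw [Measure.volume_eq_prod, Measure.prod_restrict]
    rw [this]
    exact (ae_restrict_iff' (measurableSet_Ioi.prod measurableSet_Ioi)).2
      (.of_forall fun z hz => hz)
  have hmeas : AEStronglyMeasurable (fun z : ℝ × ℝ => besselE μ (z.2 * z.1) /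
      (((1 + z.1 : ℝ) : ℂ) * ((1 + z.2 : ℝ) : ℂ))) (ρ.prod ρ) := by
    have hE : Measurable fun z : ℝ × ℝ => besselE μ (z.2 * z.1) :=
      (continuous_besselE hμ).measurable.comp (by fun_prop)
    exact (hE.div (by fun_prop)).aestronglyMeasurable
  have h_int : Integrable (Function.uncurry fun x y : ℝ =>
      ((x : ℂ) ^ μ * k x) * ((y : ℂ) ^ μ * h y * besselE μ (y * x))) (ρ.prod ρ) := by
    have h1 := Integrable.bdd_mul (c := C) (Integrable.mul_prod (μ := ρ) (ν := ρ) hk hh) hmeas ?_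
    · refine h1.congr ?_
      filter_upwards [hpos] with z hz
      have e1 : ((1 + z.1 : ℝ) : ℂ) ≠ 0 := by
        rw [Complex.ofReal_ne_zero]; linarith [hz.1]
      have e2 : ((1 + z.2 : ℝ) : ℂ) ≠ 0 := by
        rw [Complex.ofReal_ne_zero]; linarith [hz.2]
      simp only [Function.uncurry]
      field_simp
    · filter_upwards [hpos] with z hz
      have := hK z.2 z.1 hz.2 hz.1.le
      rw [norm_div] at this
      rw [norm_div, norm_mul, mul_comm ‖_‖, ← div_div, Complex.norm_real (1 + z.1),
        Real.norm_of_nonneg (by linarith [hz.1]), div_le_iff₀ (by linarith [hz.1])]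
      exact this
  have hswap := integral_integral_swap h_int
  calc ∫ x in Ioi (0 : ℝ), (x : ℂ) ^ μ * besselT μ h x * k x
      = ∫ x, ∫ y, ((x : ℂ) ^ μ * k x) * ((y : ℂ) ^ μ * h y * besselE μ (y * x)) ∂ρ ∂ρ := by
        refine integral_congr_ae (.of_forall fun x => ?_)
        simp only
        rw [integral_const_mul, besselT]
        ring
    _ = _ := hswap
    _ = _ := by
        refine integral_congr_ae (.of_forall fun y => ?_)
        simp only [besselT]
        rw [← integral_const_mul]
        refine integral_congr_ae (.of_forall fun x => ?_)
        simp only [mul_comm y x]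
        ring

lemma norm_cexp_neg_mul (s : ℂ) (x : ℝ) : ‖Complex.exp (-(s * x))‖ = Real.exp (-(s.re * x)) := by
  rw [Complex.norm_exp]
  simp

lemma weightIntegrable_cexp {μ : ℂ} (hμ : -1 < μ.re) {s : ℂ} (hs : 0 < s.re) :
    WeightIntegrable μ fun x => Complex.exp (-(s * x)) := by
  obtain ⟨m, hm⟩ := exists_nat_gt (μ.re + 2)
  refine WeightIntegrable.of_bounds hμ (by fun_prop) hm (C₀ := 1) (C₁ := m.factorial / s.re ^ m)
    (fun x hx _ => ?_) fun x hx => ?_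
  · rw [norm_cexp_neg_mul, Real.exp_le_one_iff]
    have : 0 < s.re * x := by positivity
    linarith
  · have hx0 : 0 < x := by linarith
    have := Real.pow_div_factorial_le_exp (s.re * x) (by positivity) m
    rw [norm_cexp_neg_mul, Real.exp_neg, le_div_iff₀ (by positivity), mul_comm _ (s.re ^ m),
      ← mul_assoc, ← mul_pow, mul_inv_le_iff₀ (Real.exp_pos _), ← div_le_iff₀' (by positivity)]
    exact this

lemma integrableOn_cpow_mul_cexp {μ : ℂ} (hμ : -1 < μ.re) {s : ℂ} (hs : 0 < s.re) :
    IntegrableOn (fun x : ℝ => (x : ℂ) ^ μ * Complex.exp (-(s * x))) (Ioi 0) := by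
  have hi := integrableOn_rpow_mul_exp_neg_mul_rpow hμ zero_lt_one hs
  refine Integrable.mono' hi (((continuousOn_ofReal_cpow μ).mul
    (by fun_prop)).aestronglyMeasurable measurableSet_Ioi) ?_
  refine (ae_restrict_iff' measurableSet_Ioi).2 (.of_forall fun x hx => ?_)
  rw [norm_mul, norm_cexp_neg_mul, Complex.norm_cpow_eq_rpow_re_of_pos hx, Real.rpow_one, neg_mul]

lemma differentiableAt_integral_cpow_mul_cexp {μ : ℂ} (hμ : -1 < μ.re) {s : ℂ} (hs : 0 < s.re) :
    DifferentiableAt ℂ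
      (fun s : ℂ => ∫ x in Ioi (0 : ℝ), (x : ℂ) ^ μ * Complex.exp (-(s * x))) s := by
  have hmeas (g : ℝ → ℂ) (hg : Continuous g) : AEStronglyMeasurable
      (fun x : ℝ => (x : ℂ) ^ μ * g x) (volume.restrict (Ioi 0)) :=
    ((continuousOn_ofReal_cpow μ).mul hg.continuousOn).aestronglyMeasurable measurableSet_Ioi
  have hb := integrableOn_rpow_mul_exp_neg_mul_rpow (s := μ.re + 1) (by linarith) zero_lt_one
    (half_pos hs)
  have hU : {z : ℂ | s.re / 2 < z.re} ∈ nhds s :=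
    (isOpen_lt continuous_const Complex.continuous_re).mem_nhds (half_lt_self hs)
  refine (hasDerivAt_integral_of_dominated_loc_of_deriv_le (𝕜 := ℂ) hU
    (F := fun z (x : ℝ) => (x : ℂ) ^ μ * Complex.exp (-(z * x)))
    (F' := fun z (x : ℝ) => (x : ℂ) ^ μ * (Complex.exp (-(z * x)) * (-x)))
    (.of_forall fun z => hmeas _ (by fun_prop)) (integrableOn_cpow_mul_cexp hμ hs)
    (hmeas _ (by fun_prop)) ?_ hb ?_).2.differentiableAt
  · refine (ae_restrict_iff' measurableSet_Ioi).2 (.of_forall fun x hx z hz => ?_)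
    have hx0 : 0 < x := hx
    rw [norm_mul, norm_mul, norm_cexp_neg_mul, Complex.norm_cpow_eq_rpow_re_of_pos hx0,
      Real.rpow_one, norm_neg, Complex.norm_real, Real.norm_of_nonneg hx0.le,
      Real.rpow_add hx0, Real.rpow_one, mul_comm (Real.exp _), ← mul_assoc]
    gcongr
    rw [neg_mul, neg_le_neg_iff]
    have : s.re / 2 < z.re := hz
    gcongr
  · refine .of_forall fun x z _ => ?_
    have : HasDerivAt (fun z : ℂ => -(z * x)) (-(x : ℂ)) z := 
      (hasDerivAt_mul_const (x : ℂ)).fun_neg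
    exact this.cexp.const_mul _

lemma integral_cpow_mul_cexp {μ : ℂ} (hμ : -1 < μ.re) {s : ℂ} (hs : 0 < s.re) :
    ∫ x in Ioi (0 : ℝ), (x : ℂ) ^ μ * Complex.exp (-(s * x)) =
      (1 / s) ^ (μ + 1) * Complex.Gamma (μ + 1) := by
  let U : Set ℂ := {z | 0 < z.re}
  have hU : IsOpen U := isOpen_lt continuous_const Complex.continuous_re
  have hf : AnalyticOnNhd ℂ
      (fun s : ℂ => ∫ x in Ioi (0 : ℝ), (x : ℂ) ^ μ * Complex.exp (-(s * x))) U :=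
    DifferentiableOn.analyticOnNhd
      (fun z hz => (differentiableAt_integral_cpow_mul_cexp hμ hz).differentiableWithinAt) hU
  have hg : AnalyticOnNhd ℂ
      (fun s : ℂ => (1 / s) ^ (μ + 1) * Complex.Gamma (μ + 1)) U := by
    refine DifferentiableOn.analyticOnNhd (fun z hz => ?_) hU
    have hz' : 0 < z.re := hz
    have hz0 : z ≠ 0 := by rintro rfl; simp at hz'
    have hsl : 1 / z ∈ Complex.slitPlane := by
      refine Or.inl ?_
      rw [one_div, Complex.inv_re]
      exact div_pos hz' (Complex.normSq_pos.2 hz0)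
    refine DifferentiableAt.differentiableWithinAt (DifferentiableAt.mul_const ?_ _)
    exact ((differentiableAt_const _).div differentiableAt_id hz0).cpow
      (differentiableAt_const _) hsl
  have hpre : IsPreconnected U := (convex_halfSpace_re_gt 0).isPreconnected
  refine hf.eqOn_of_preconnected_of_frequently_eq hg hpre (z₀ := 1) (by simp [U]) ?_ hs
  have ht : Filter.Tendsto (fun t : ℝ => (t : ℂ)) (nhdsWithin 1 {1}ᶜ) (nhdsWithin 1 {1}ᶜ) := by
    refine tendsto_nhdsWithin_iff.2 ⟨?_, ?_⟩
    · exact (Complex.continuous_ofReal.tendsto' 1 1 (by simp)).mono_left nhdsWithin_le_nhds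
    · filter_upwards [self_mem_nhdsWithin] with t ht
      simpa using ht
  refine ht.frequently (Filter.Eventually.frequently ?_)
  filter_upwards [nhdsWithin_le_nhds (lt_mem_nhds zero_lt_one)] with t ht
  have := Complex.integral_cpow_mul_exp_neg_mul_Ioi (a := μ + 1) (r := t) (by simp; linarith) ht
  rw [add_sub_cancel_right] at this
  exact this

lemma besselT_cexp {μ : ℂ} (hμ : -1 < μ.re) {s : ℂ} (hs : 0 < s.re) {y : ℝ} (hy : 0 ≤ y) :
    besselT μ (fun x => Complex.exp (-(s * x))) y =
      (1 / s) ^ (μ + 1) * Complex.exp (-(1 / s * y)) := by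
  have hs0 : s ≠ 0 := by rintro rfl; simp at hs
  have hμk (k : ℕ) : -1 < (μ + k).re := by
    have : (0 : ℝ) ≤ k := k.cast_nonneg
    simp
    linarith
  let F : ℕ → ℝ → ℂ := fun k x => (-1 : ℂ) ^ k * besselCoeff μ k * ((y ^ k / k.factorial : ℝ) : ℂ) *
    ((x : ℂ) ^ (μ + k) * Complex.exp (-(s * x)))
  have hFint (k : ℕ) : Integrable (F k) (volume.restrict (Ioi 0)) :=
    Integrable.const_mul (integrableOn_cpow_mul_cexp (hμk k) hs) _
  have hnorm (k : ℕ) : ∫ x in Ioi (0 : ℝ), ‖F k x‖ =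
      (‖besselCoeff μ k‖ * Real.Gamma (k + μ.re + 1)) * (1 / s.re) ^ (μ.re + 1) *
        ((y / s.re) ^ k / k.factorial) := by
    have hk : (0 : ℝ) ≤ k := k.cast_nonneg
    have hpt : EqOn (fun x => ‖F k x‖) (fun x : ℝ => ‖besselCoeff μ k‖ * (y ^ k / k.factorial) *
        (x ^ ((k + μ.re + 1) - 1) * Real.exp (-(s.re * x)))) (Ioi 0) := fun x hx => by
      simp only [F]
      rw [norm_mul, norm_mul, norm_mul, norm_mul, norm_pow, norm_neg, norm_one, one_pow, one_mul,
        Complex.norm_real, Real.norm_of_nonneg (by positivity), norm_cexp_neg_mul,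
        Complex.norm_cpow_eq_rpow_re_of_pos hx]
      simp [add_comm]
    rw [setIntegral_congr_fun measurableSet_Ioi hpt, integral_const_mul,
      Real.integral_rpow_mul_exp_neg_mul_Ioi (by linarith) hs,
      show (k : ℝ) + μ.re + 1 = (μ.re + 1) + k by ring, Real.rpow_add (by positivity),
      Real.rpow_natCast, div_pow, div_pow, one_pow]
    ring
  have hsum : Summable fun k => ∫ x in Ioi (0 : ℝ), ‖F k x‖ := by
    simp_rw [hnorm]
    refine Summable.of_nonneg_of_le (fun k => ?_) (fun k => ?_)
      ((Real.summable_pow_div_factorial (y / s.re)).mul_left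
        ((‖besselCoeff μ 0‖ * Real.Gamma (μ.re + 1)) * (1 / s.re) ^ (μ.re + 1)))
    · rw [← hnorm]
      exact integral_nonneg fun x => norm_nonneg _
    · have hy' : 0 ≤ (y / s.re) ^ k / k.factorial := by positivity
      have hs' : 0 ≤ (1 / s.re) ^ (μ.re + 1) := by positivity
      exact mul_le_mul_of_nonneg_right (mul_le_mul_of_nonneg_right
        (norm_besselCoeff_mul_Gamma_le hμ k) hs') hy'
  have hFk (k : ℕ) : ∫ x in Ioi (0 : ℝ), F k x =
      (1 / s) ^ (μ + 1) * ((-(1 / s * y)) ^ k / k.factorial) := by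
    simp only [F]
    rw [integral_const_mul, integral_cpow_mul_cexp (hμk k) hs]
    have hG : Complex.Gamma (k + μ + 1) ≠ 0 := by
      refine Complex.Gamma_ne_zero_of_re_pos ?_
      have := hμk k
      simp at this ⊢
      linarith
    rw [show μ + k + 1 = (k : ℂ) + μ + 1 by ring, besselCoeff,
      show (k : ℂ) + μ + 1 = (μ + 1) + k by ring, Complex.cpow_add _ _ (one_div_ne_zero hs0),
      Complex.cpow_natCast, neg_pow (1 / s * (y : ℂ)), mul_pow (1 / s)]
    rw [show (k : ℂ) + μ + 1 = (μ + 1) + k by ring] at hG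
    have : (k.factorial : ℂ) ≠ 0 := by exact_mod_cast k.factorial_ne_zero
    push_cast
    field_simp
  have hS := hasSum_integral_of_summable_integral_norm hFint hsum
  have hE : HasSum (fun k => ∫ x in Ioi (0 : ℝ), F k x)
      ((1 / s) ^ (μ + 1) * Complex.exp (-(1 / s * y))) := by
    simp_rw [hFk]
    rw [Complex.exp_eq_exp_ℂ]
    exact (NormedSpace.expSeries_div_hasSum_exp (-(1 / s * (y : ℂ)))).mul_left _
  rw [← hS.unique hE, besselT]
  refine setIntegral_congr_fun measurableSet_Ioi fun x hx => ?_
  have hx0 : (x : ℂ) ≠ 0 := Complex.ofReal_ne_zero.2 (ne_of_gt hx)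
  simp only [F, besselE]
  rw [← tsum_mul_left]
  refine tsum_congr fun k => ?_
  rw [Complex.cpow_add _ _ hx0, Complex.cpow_natCast, mul_pow]
  push_cast
  ring

lemma besselT_besselT_cexp {μ : ℂ} (hμ : -1 < μ.re) {s : ℂ} (hs : 0 < s.re) {y : ℝ}
    (hy : 0 ≤ y) :
    besselT μ (besselT μ fun x => Complex.exp (-(s * x))) y = Complex.exp (-(s * y)) := by
  have hs0 : s ≠ 0 := by rintro rfl; simp at hs
  have hs' : 0 < (1 / s).re := by
    rw [one_div, Complex.inv_re]
    exact div_pos hs (Complex.normSq_pos.2 hs0)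
  have hmul : besselT μ (besselT μ fun x => Complex.exp (-(s * x))) y =
      (1 / s) ^ (μ + 1) * besselT μ (fun x => Complex.exp (-(1 / s * x))) y := by
    rw [besselT, besselT, ← integral_const_mul]
    refine setIntegral_congr_fun measurableSet_Ioi fun x hx => ?_
    rw [besselT_cexp hμ hs (le_of_lt hx)]
    ring
  have harg : s.arg ≠ Real.pi := by
    intro h
    have := (Complex.abs_arg_lt_pi_div_two_iff (z := s)).2 (Or.inl hs)
    rw [h, abs_of_pos Real.pi_pos] at this
    linarith [Real.pi_pos]
  have hpow : s ^ (μ + 1) ≠ 0 := by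
    rw [Complex.cpow_def_of_ne_zero hs0]
    exact Complex.exp_ne_zero _
  rw [hmul, besselT_cexp hμ hs' hy, one_div_one_div, ← mul_assoc, one_div,
    Complex.inv_cpow _ _ harg, inv_mul_cancel₀ hpow, one_mul]

lemma RapidlyDecreasing.deriv {g : ℝ → ℂ} (hg : RapidlyDecreasing g) :
    RapidlyDecreasing (deriv g) := fun m n => by
  obtain ⟨C, hC⟩ := hg m (n + 1)
  exact ⟨C, fun x hx => by rw [← iteratedDeriv_succ']; exact hC x hx⟩

lemma weightIntegrable_of_rapidlyDecreasing {μ : ℂ} (hμ : -1 < μ.re) {g : ℝ → ℂ}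
    (hc : Continuous g) (hg : RapidlyDecreasing g) : WeightIntegrable μ g := by
  obtain ⟨m, hm⟩ := exists_nat_gt (μ.re + 2)
  obtain ⟨C₁, h₁⟩ := hg m 0
  obtain ⟨C₀, h₀⟩ := (isCompact_Icc (a := (0 : ℝ)) (b := 1)).exists_bound_of_continuousOn
    hc.continuousOn
  exact WeightIntegrable.of_bounds hμ hc.continuousOn hm (fun x hx hx' => h₀ x ⟨hx.le, hx'⟩)
    (by simpa using h₁)

lemma hasDerivAt_cpow_mul_besselE {μ : ℂ} (hμ : -1 < μ.re) (y : ℝ) {x : ℝ} (hx : 0 < x) :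
    HasDerivAt (fun x : ℝ => (x : ℂ) ^ (μ + 1) * besselE (μ + 1) (x * y))
      ((x : ℂ) ^ μ * besselE μ (x * y)) x := by
  have hμ1 : -1 < (μ + 1).re := by simp; linarith
  have hμ0 : μ + 1 ≠ 0 := by
    intro h
    have := congrArg Complex.re h
    simp at this
    linarith
  have hx0 : (x : ℂ) ≠ 0 := Complex.ofReal_ne_zero.2 hx.ne'
  have h1 : HasDerivAt (fun x : ℝ => (x : ℂ) ^ (μ + 1)) ((μ + 1) * (x : ℂ) ^ μ) x := by
    have := (hasDerivAt_id (x : ℂ)).cpow_const (c := μ + 1) (Or.inl (by simpa using hx))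
    simpa using this.comp_ofReal
  have h2 : HasDerivAt (fun x : ℝ => besselE (μ + 1) (x * y))
      (y • -besselE (μ + 1 + 1) (x * y)) x :=
    HasDerivAt.scomp (h := fun x : ℝ => x * y) x (hasDerivAt_besselE hμ1 (x * y))
      (hasDerivAt_mul_const y)
  convert! h1.mul h2 using 1
  rw [besselE_eq hμ, Complex.cpow_add _ _ hx0, Complex.cpow_one, show μ + 1 + 1 = μ + 2 by ring,
    Complex.real_smul]
  push_cast
  ring

lemma besselT_eq_neg_besselT_deriv {μ : ℂ} (hμ : -1 < μ.re) {g : ℝ → ℂ}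
    (hc : ContDiff ℝ (⊤ : ℕ∞) g) (hg : RapidlyDecreasing g) {y : ℝ} (hy : 0 ≤ y) :
    besselT μ g y = -besselT (μ + 1) (deriv g) y := by
  have hμ1 : -1 < (μ + 1).re := by simp; linarith
  have hc' : Continuous (deriv g) := hc.continuous_deriv (by simp)
  have hd : Differentiable ℝ g := hc.differentiable (by simp)
  have hu (x : ℝ) (hx : x ∈ Ioi (0 : ℝ)) := hasDerivAt_cpow_mul_besselE hμ y hx
  have hv (x : ℝ) (_ : x ∈ Ioi (0 : ℝ)) := (hd x).hasDerivAt
  have hi1 := (weightIntegrable_of_rapidlyDecreasing hμ1 hc' hg.deriv).integrableOn_mul_besselE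
    hμ1 hy
  have hi2 := (weightIntegrable_of_rapidlyDecreasing hμ hc.continuous hg).integrableOn_mul_besselE
    hμ hy
  have hi3 := (weightIntegrable_of_rapidlyDecreasing hμ1 hc.continuous hg).integrableOn_mul_besselE
    hμ1 hy
  have huv' : IntegrableOn ((fun x : ℝ => (x : ℂ) ^ (μ + 1) * besselE (μ + 1) (x * y)) * deriv g)
      (Ioi 0) := hi1.congr_fun (fun x _ => by simp only [Pi.mul_apply]; ring) measurableSet_Ioi
  have hu'v : IntegrableOn ((fun x : ℝ => (x : ℂ) ^ μ * besselE μ (x * y)) * g)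
      (Ioi 0) := hi2.congr_fun (fun x _ => by simp only [Pi.mul_apply]; ring) measurableSet_Ioi
  have huv : IntegrableOn ((fun x : ℝ => (x : ℂ) ^ (μ + 1) * besselE (μ + 1) (x * y)) * g)
      (Ioi 0) := hi3.congr_fun (fun x _ => by simp only [Pi.mul_apply]; ring) measurableSet_Ioi
  have hzero : Filter.Tendsto ((fun x : ℝ => (x : ℂ) ^ (μ + 1) * besselE (μ + 1) (x * y)) * g)
      (nhdsWithin 0 (Ioi 0)) (nhds 0) := by
    have h1 : ContinuousAt (fun x : ℝ => (x : ℂ) ^ (μ + 1)) 0 :=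
      Complex.continuousAt_ofReal_cpow_const 0 (μ + 1) (Or.inl (by simp; linarith))
    have h2 : ContinuousAt (fun x : ℝ => besselE (μ + 1) (x * y)) 0 :=
      ((continuous_besselE hμ1).comp (by fun_prop)).continuousAt
    have h3 := ((h1.mul h2).mul hc.continuous.continuousAt).tendsto.mono_left
      (nhdsWithin_le_nhds (s := Ioi 0))
    have h0 : μ + 1 ≠ 0 := by
      intro h
      have := congrArg Complex.re h
      simp at this
      linarith
    simp [Complex.zero_cpow h0] at h3
    exact h3
  have hinfty := tendsto_zero_of_hasDerivAt_of_integrableOn_Ioi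
    (fun x hx => (hu x hx).mul (hv x hx)) (hu'v.add huv') huv
  have key := integral_Ioi_mul_deriv_eq_deriv_mul hu hv huv' hu'v hzero hinfty
  rw [sub_zero, zero_sub] at key
  have e1 : besselT μ g y = ∫ x in Ioi (0 : ℝ), (x : ℂ) ^ μ * besselE μ (x * y) * g x :=
    setIntegral_congr_fun measurableSet_Ioi fun x _ => by ring
  have e2 : besselT (μ + 1) (deriv g) y =
      ∫ x in Ioi (0 : ℝ), (x : ℂ) ^ (μ + 1) * besselE (μ + 1) (x * y) * deriv g x :=
    setIntegral_congr_fun measurableSet_Ioi fun x _ => by ring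
  rw [e1, e2, key, neg_neg]

lemma norm_besselT_eq_iteratedDeriv (n : ℕ) {μ : ℂ} (hμ : -1 < μ.re) {g : ℝ → ℂ}
    (hc : ContDiff ℝ (⊤ : ℕ∞) g) (hg : RapidlyDecreasing g) {y : ℝ} (hy : 0 ≤ y) :
    ‖besselT μ g y‖ = ‖besselT (μ + n) (iteratedDeriv n g) y‖ := by
  induction n generalizing μ g with
  | zero => simp
  | succ n ih =>
    have hc' : ContDiff ℝ (⊤ : ℕ∞) (deriv g) := (contDiff_infty_iff_deriv.1 hc).2
    rw [besselT_eq_neg_besselT_deriv hμ hc hg hy, norm_neg,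
      ih (by simp; linarith) hc' hg.deriv, iteratedDeriv_succ']
    congr 2
    push_cast
    ring

lemma RapidlyDecreasing.iteratedDeriv {g : ℝ → ℂ} (hg : RapidlyDecreasing g) (k : ℕ) :
    RapidlyDecreasing (iteratedDeriv k g) := by
  induction k with
  | zero => simpa using hg
  | succ k ih => rw [iteratedDeriv_succ]; exact ih.deriv

lemma exists_pow_mul_norm_besselT_le {μ : ℂ} (hμ : -1 < μ.re) {g : ℝ → ℂ}
    (hc : ContDiff ℝ (⊤ : ℕ∞) g) (hg : RapidlyDecreasing g) (m : ℕ) :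
    ∃ C : ℝ, ∀ y : ℝ, 0 < y → y ^ m * ‖besselT μ g y‖ ≤ C := by
  have hm : (0 : ℝ) ≤ m := m.cast_nonneg
  obtain ⟨C, hC⟩ := exists_pow_mul_norm_besselE_le m (μ := μ + (2 * m + 1 : ℕ))
    (by simp; linarith)
  have hC0 : 0 ≤ C := by
    refine le_trans ?_ (hC 1 zero_le_one)
    positivity
  let h := _root_.iteratedDeriv (2 * m + 1) g
  have hi : WeightIntegrable (μ + (m + 1 : ℕ)) h :=
    weightIntegrable_of_rapidlyDecreasing (by simp; linarith)
      (hc.continuous_iteratedDeriv _ (WithTop.coe_le_coe.2 le_top)) (hg.iteratedDeriv _)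
  refine ⟨∫ x in Ioi (0 : ℝ), C * ‖(x : ℂ) ^ (μ + (m + 1 : ℕ)) * h x * ((1 + x : ℝ) : ℂ)‖,
    fun y hy => ?_⟩
  rw [norm_besselT_eq_iteratedDeriv (2 * m + 1) hμ hc hg hy.le]
  have : y ^ m * ‖besselT (μ + (2 * m + 1 : ℕ)) h y‖ =
      ‖(y : ℂ) ^ m * besselT (μ + (2 * m + 1 : ℕ)) h y‖ := by
    rw [norm_mul, norm_pow, Complex.norm_real, Real.norm_of_nonneg hy.le]
  rw [this, besselT, ← integral_const_mul]
  refine norm_integral_le_of_norm_le ((Integrable.norm hi).const_mul _)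
    ((ae_restrict_iff' measurableSet_Ioi).2 (.of_forall fun x hx => ?_))
  have hx0 : 0 < x := hx
  have hxc : (x : ℂ) ≠ 0 := Complex.ofReal_ne_zero.2 hx0.ne'
  rw [show μ + (2 * m + 1 : ℕ) = (μ + (m + 1 : ℕ)) + (m : ℕ) by push_cast; ring,
    Complex.cpow_add _ _ hxc, Complex.cpow_natCast]
  rw [show μ + (2 * m + 1 : ℕ) = (μ + (m + 1 : ℕ)) + (m : ℕ) by push_cast; ring] at hC
  generalize μ + (m + 1 : ℕ) = lam at *
  simp only [norm_mul, norm_pow, Complex.norm_real, Real.norm_of_nonneg hy.le,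
    Real.norm_of_nonneg hx0.le, Real.norm_of_nonneg (by linarith : 0 ≤ 1 + x)]
  have hE := hC (x * y) (by positivity)
  calc _ = ((x * y) ^ m * ‖besselE (lam + m) (x * y)‖) * (‖(x : ℂ) ^ lam‖ * ‖h x‖) := by ring
    _ ≤ C * (‖(x : ℂ) ^ lam‖ * ‖h x‖ * 1) := by rw [mul_one]; gcongr
    _ ≤ _ := by gcongr; linarith

lemma weightIntegrable_besselT {μ : ℂ} (hμ : -1 < μ.re) {g : ℝ → ℂ}
    (hc : ContDiff ℝ (⊤ : ℕ∞) g) (hg : RapidlyDecreasing g) :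
    WeightIntegrable μ (besselT μ g) := by
  have hw := weightIntegrable_of_rapidlyDecreasing hμ hc.continuous hg
  obtain ⟨m, hm⟩ := exists_nat_gt (μ.re + 2)
  obtain ⟨C₁, h₁⟩ := exists_pow_mul_norm_besselT_le hμ hc hg m
  obtain ⟨C₀, h₀⟩ := hw.exists_norm_besselT_le hμ
  have hC₀ : 0 ≤ C₀ := by simpa using (norm_nonneg _).trans (h₀ 0 le_rfl)
  refine WeightIntegrable.of_bounds hμ (hw.continuousOn_besselT hμ) hm (C₀ := C₀ * 2)
    (fun x hx hx' => (h₀ x hx.le).trans ?_) fun x hx => h₁ x (by linarith)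
  gcongr
  linarith

lemma weightIntegrable_besselT_cexp {μ : ℂ} (hμ : -1 < μ.re) {s : ℂ} (hs : 0 < s.re) :
    WeightIntegrable μ (besselT μ fun x => Complex.exp (-(s * x))) := by
  have hs0 : s ≠ 0 := by rintro rfl; simp at hs
  have hs' : 0 < (1 / s).re := by
    rw [one_div, Complex.inv_re]
    exact div_pos hs (Complex.normSq_pos.2 hs0)
  refine IntegrableOn.congr_fun ((weightIntegrable_cexp hμ hs').const_mul ((1 / s) ^ (μ + 1)))
    (fun x hx => ?_) measurableSet_Ioi
  rw [besselT_cexp hμ hs (le_of_lt hx)]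
  ring

lemma integral_besselT_besselT_mul_cexp {μ : ℂ} (hμ : -1 < μ.re) {g : ℝ → ℂ}
    (hg : WeightIntegrable μ g) (hT : WeightIntegrable μ (besselT μ g)) {s : ℂ} (hs : 0 < s.re) :
    ∫ x in Ioi (0 : ℝ), (x : ℂ) ^ μ * besselT μ (besselT μ g) x * Complex.exp (-(s * x)) =
      ∫ x in Ioi (0 : ℝ), (x : ℂ) ^ μ * g x * Complex.exp (-(s * x)) := by
  rw [integral_besselT_mul hμ hT (weightIntegrable_cexp hμ hs),
    integral_besselT_mul hμ hg (weightIntegrable_besselT_cexp hμ hs)]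
  refine setIntegral_congr_fun measurableSet_Ioi fun x hx => ?_
  rw [besselT_besselT_cexp hμ hs (le_of_lt hx)]

lemma WeightIntegrable.integrableOn_mul_cexp {μ : ℂ} {g : ℝ → ℂ}
    (hg : WeightIntegrable μ g) {s : ℂ} (hs : 0 < s.re) :
    IntegrableOn (fun x : ℝ => (x : ℂ) ^ μ * g x * Complex.exp (-(s * x))) (Ioi 0) := by
  have hne (x : ℝ) (hx : x ∈ Ioi (0 : ℝ)) : ((1 + x : ℝ) : ℂ) ≠ 0 := by
    have : 0 < x := hx
    rw [Complex.ofReal_ne_zero]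
    linarith
  have hcont : ContinuousOn (fun x : ℝ => Complex.exp (-(s * x)) / ((1 + x : ℝ) : ℂ)) (Ioi 0) :=
    ContinuousOn.div (by fun_prop) (by fun_prop) hne
  refine IntegrableOn.congr_fun (Integrable.bdd_mul (c := 1) hg
    (hcont.aestronglyMeasurable measurableSet_Ioi)
    ((ae_restrict_iff' measurableSet_Ioi).2 (.of_forall fun x hx => ?_)))
    (fun x hx => ?_) measurableSet_Ioi
  · have hx0 : 0 < x := hx
    rw [norm_div, norm_cexp_neg_mul, Complex.norm_real, Real.norm_of_nonneg (by linarith),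
      div_le_one (by linarith)]
    have : Real.exp (-(s.re * x)) ≤ 1 := Real.exp_le_one_iff.2 (by
      have : 0 < s.re * x := by positivity
      linarith)
    linarith
  · have := hne x hx
    field_simp

lemma WeightIntegrable.integrableOn_besselT_mul_cexp {μ : ℂ} (hμ : -1 < μ.re) {g : ℝ → ℂ}
    (hg : WeightIntegrable μ g) {s : ℂ} (hs : 0 < s.re) :
    IntegrableOn (fun x : ℝ => (x : ℂ) ^ μ * besselT μ g x * Complex.exp (-(s * x))) (Ioi 0) := by
  obtain ⟨C, hC⟩ := hg.exists_norm_besselT_le hμ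
  have hne (x : ℝ) (hx : x ∈ Ioi (0 : ℝ)) : ((1 + x : ℝ) : ℂ) ≠ 0 := by
    have : 0 < x := hx
    rw [Complex.ofReal_ne_zero]
    linarith
  have hcont : ContinuousOn (fun x : ℝ => besselT μ g x / ((1 + x : ℝ) : ℂ)) (Ioi 0) :=
    ContinuousOn.div (hg.continuousOn_besselT hμ) (by fun_prop) hne
  refine IntegrableOn.congr_fun (Integrable.bdd_mul (c := C) (weightIntegrable_cexp hμ hs)
    (hcont.aestronglyMeasurable measurableSet_Ioi)
    ((ae_restrict_iff' measurableSet_Ioi).2 (.of_forall fun x hx => ?_)))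
    (fun x hx => ?_) measurableSet_Ioi
  · have hx0 : 0 < x := hx
    rw [norm_div, Complex.norm_real, Real.norm_of_nonneg (by linarith),
      div_le_iff₀ (by linarith)]
    exact hC x hx0.le
  · have := hne x hx
    beta_reduce
    field_simp

open FourierTransform in
/-- A function on `(0, ∞)` whose Laplace transform vanishes on the line `re s = 1` vanishes at
its points of continuity. -/
lemma eq_zero_of_integral_mul_cexp_eq_zero {φ : ℝ → ℂ} (hc : ContinuousOn φ (Ioi 0))
    (hi : IntegrableOn (fun x : ℝ => φ x * Complex.exp (-(1 * x))) (Ioi 0))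
    (h0 : ∀ s : ℂ, s.re = 1 → ∫ x in Ioi (0 : ℝ), φ x * Complex.exp (-(s * x)) = 0)
    {y : ℝ} (hy : 0 < y) : φ y = 0 := by
  let ψ : ℝ → ℂ := (Ioi (0 : ℝ)).indicator fun x : ℝ => φ x * Complex.exp (-(1 * x))
  have hψ : Integrable ψ := (integrable_indicator_iff measurableSet_Ioi).2 hi
  have hF : 𝓕 ψ = fun _ => 0 := by
    funext w
    rw [Real.fourier_real_eq_integral_exp_smul]
    rw [← h0 (1 + 2 * Real.pi * w * Complex.I) (by simp), ← integral_indicator measurableSet_Ioi]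
    refine integral_congr_ae (.of_forall fun x => ?_)
    by_cases hx : x ∈ Ioi (0 : ℝ)
    · simp only [ψ, indicator_of_mem hx, smul_eq_mul]
      rw [mul_left_comm, ← Complex.exp_add]
      congr 2
      push_cast
      ring
    · simp [ψ, indicator_of_notMem hx]
  have hcont : ContinuousAt ψ y := by
    have h1 : ContinuousAt (fun x : ℝ => φ x * Complex.exp (-(1 * x))) y :=
      (hc.continuousAt (Ioi_mem_nhds hy)).mul (by fun_prop)
    refine h1.congr ?_
    filter_upwards [Ioi_mem_nhds hy] with x hx
    simp [ψ, indicator_of_mem hx]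
  have hinv := hψ.fourierInv_fourier_eq (by rw [hF]; exact integrable_zero _ _ _) hcont
  rw [hF, Real.fourierInv_eq] at hinv
  simp only [smul_zero, integral_zero] at hinv
  have : φ y * Complex.exp (-(1 * y)) = 0 := by
    rw [hinv]
    simp [ψ, hy]
  exact (mul_eq_zero.1 this).resolve_right (Complex.exp_ne_zero _)

lemma besselT_besselT {μ : ℂ} (hμ : -1 < μ.re) {g : ℝ → ℂ} (hc : ContDiff ℝ (⊤ : ℕ∞) g)
    (hg : RapidlyDecreasing g) {y : ℝ} (hy : 0 < y) : besselT μ (besselT μ g) y = g y := by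
  have hw := weightIntegrable_of_rapidlyDecreasing hμ hc.continuous hg
  have hT := weightIntegrable_besselT hμ hc hg
  have h_int (s : ℂ) (hs : 0 < s.re) :=
    (hT.integrableOn_besselT_mul_cexp hμ hs).sub (hw.integrableOn_mul_cexp hs)
  have heq (s : ℂ) : (fun x : ℝ => (x : ℂ) ^ μ * (besselT μ (besselT μ g) x - g x) *
      Complex.exp (-(s * x))) = (fun x : ℝ => (x : ℂ) ^ μ * besselT μ (besselT μ g) x *
      Complex.exp (-(s * x))) - fun x : ℝ => (x : ℂ) ^ μ * g x * Complex.exp (-(s * x)) := by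
    funext x
    simp only [Pi.sub_apply]
    ring
  have key : (y : ℂ) ^ μ * (besselT μ (besselT μ g) y - g y) = 0 := by
    refine eq_zero_of_integral_mul_cexp_eq_zero
      (φ := fun x : ℝ => (x : ℂ) ^ μ * (besselT μ (besselT μ g) x - g x)) ?_ ?_
      (fun s hs => ?_) hy
    · exact (continuousOn_ofReal_cpow μ).mul
        ((hT.continuousOn_besselT hμ).sub hc.continuous.continuousOn)
    · rw [heq]
      exact h_int 1 (by simp)
    · have hs0 : 0 < s.re := by linarith
      rw [heq, integral_sub' (hT.integrableOn_besselT_mul_cexp hμ hs0)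
        (hw.integrableOn_mul_cexp hs0), integral_besselT_besselT_mul_cexp hμ hw hT hs0, sub_self]
  have hy0 : (y : ℂ) ≠ 0 := Complex.ofReal_ne_zero.2 hy.ne'
  refine sub_eq_zero.1 ((mul_eq_zero.1 key).resolve_left ?_)
  rw [Complex.cpow_def_of_ne_zero hy0]
  exact Complex.exp_ne_zero _

lemma ofReal_sqrt_cpow {x : ℝ} (hx : 0 < x) (a : ℂ) :
    ((Real.sqrt x : ℝ) : ℂ) ^ a = (x : ℂ) ^ (a / 2) := by
  have hx0 : (x : ℂ) ≠ 0 := Complex.ofReal_ne_zero.2 hx.ne'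
  have hs0 : ((Real.sqrt x : ℝ) : ℂ) ≠ 0 := Complex.ofReal_ne_zero.2 (Real.sqrt_pos.2 hx).ne'
  rw [Complex.cpow_def_of_ne_zero hx0, Complex.cpow_def_of_ne_zero hs0, ← Complex.ofReal_log hx.le,
    ← Complex.ofReal_log (Real.sqrt_nonneg x), Real.log_sqrt hx.le]
  congr 1
  push_cast
  ring

lemma besselJ_two_mul_sqrt (ν : ℂ) {u : ℝ} (hu : 0 < u) :
    besselJ ν (2 * Real.sqrt u) = (u : ℂ) ^ (ν / 2) * besselE ν u := by
  have hu0 : (u : ℂ) ≠ 0 := Complex.ofReal_ne_zero.2 hu.ne'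
  unfold besselJ besselE besselCoeff
  rw [← tsum_mul_left]
  refine tsum_congr fun k => ?_
  rw [mul_div_cancel_left₀ _ (two_ne_zero' ℝ), ofReal_sqrt_cpow hu,
    show (ν + 2 * (k : ℂ)) / 2 = ν / 2 + k by ring, Complex.cpow_add _ _ hu0,
    Complex.cpow_natCast, Complex.Gamma_nat_eq_factorial]
  push_cast
  ring

lemma hankel_eq_besselT {ν : ℂ} {f g : ℝ → ℂ}
    (hf : ∀ x : ℝ, 0 < x → f x = (x : ℂ) ^ ((ν + 1) / 2) * g x) {y : ℝ} (hy : 0 < y) :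
    hankel ν f y = (y : ℂ) ^ ((ν + 1) / 2) * besselT ν g y := by
  have hy0 : (y : ℂ) ≠ 0 := Complex.ofReal_ne_zero.2 hy.ne'
  rw [hankel, besselT, ← integral_const_mul]
  refine setIntegral_congr_fun measurableSet_Ioi fun x hx => ?_
  have hx' : 0 < x := hx
  have hx0 : (x : ℂ) ≠ 0 := Complex.ofReal_ne_zero.2 hx'.ne'
  have hxy : 0 < x * y := mul_pos hx' hy
  have hxy0 : ((x * y : ℝ) : ℂ) ≠ 0 := Complex.ofReal_ne_zero.2 hxy.ne'
  have hsq : ((Real.sqrt (x * y) : ℝ) : ℂ) * ((x * y : ℝ) : ℂ) ^ (ν / 2) =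
      (x : ℂ) ^ ((ν + 1) / 2) * (y : ℂ) ^ ((ν + 1) / 2) := by
    rw [← Complex.cpow_one ((Real.sqrt (x * y) : ℝ) : ℂ), ofReal_sqrt_cpow hxy,
      ← Complex.cpow_add _ _ hxy0, Complex.ofReal_mul,
      Complex.mul_cpow_ofReal_nonneg hx'.le hy.le]
    ring_nf
  have hpow : (x : ℂ) ^ ((ν + 1) / 2) * (x : ℂ) ^ ((ν + 1) / 2) = (x : ℂ) ^ ν * x := by
    rw [← Complex.cpow_add _ _ hx0, show (ν + 1) / 2 + (ν + 1) / 2 = ν + 1 by ring,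
      Complex.cpow_add _ _ hx0, Complex.cpow_one]
  rw [besselJ_two_mul_sqrt ν hxy, hf x hx', div_eq_iff hx0]
  calc _ = (x : ℂ) ^ ((ν + 1) / 2) * g x * besselE ν (x * y) *
        (((Real.sqrt (x * y) : ℝ) : ℂ) * ((x * y : ℝ) : ℂ) ^ (ν / 2)) := by ring
    _ = ((x : ℂ) ^ ((ν + 1) / 2) * (x : ℂ) ^ ((ν + 1) / 2)) *
        (g x * besselE ν (x * y) * (y : ℂ) ^ ((ν + 1) / 2)) := by rw [hsq]; ring
    _ = _ := by rw [hpow]; ring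

/-- Hankel inversion formula: for `Re ν > -1` and `f ∈ S_ν([0,∞))`,
`H_ν(H_ν(f))(y) = f(y)` for all `y > 0`. -/
theorem hankel_inversion (ν : ℂ) (hν : -1 < ν.re) (f : ℝ → ℂ) (hf : MemSnu ν f) :
    ∀ y : ℝ, 0 < y → hankel ν (hankel ν f) y = f y := by
  intro y hy
  obtain ⟨f₁, ⟨g, hc, hfg, hg⟩, hf₁⟩ := hf
  have hf' (x : ℝ) (hx : 0 < x) : f x = (x : ℂ) ^ ((ν + 1) / 2) * g x := by
    rw [hf₁ x hx.le, hfg x hx.le]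
  rw [hankel_eq_besselT (fun x hx => hankel_eq_besselT hf' hx) hy, besselT_besselT hν hc hg hy,
    hf' y hy]
end

section
/- Let ν ∈ ℂ with Re(ν) > −1 and let f ∈ S_ν([0,∞)). Then T_ν(f) is a smooth function on ℝ, and the function x ↦ W_ν(T_ν(f))(x) = |x|^{−ν−1} e^{sgn(x)πi(ν+1)/2} T_ν(f)(−1/x) (defined for x ≠ 0) extends to a smooth function on ℝ. -/
open MeasureTheory Set

/-- The operator `T_ν(f)(z) = (2π)^{-1/2} ∫₀^∞ x^{(ν-1)/2} f(x) e^{ixz} dx`. -/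
noncomputable def Tnu (ν : ℂ) (f : ℝ → ℂ) (z : ℝ) : ℂ :=
  (((2 * Real.pi) ^ (-(1 : ℝ) / 2) : ℝ) : ℂ) *
    ∫ x in Ioi (0 : ℝ), (x : ℂ) ^ ((ν - 1) / 2) * f x * Complex.exp (Complex.I * x * z)

/-- The operator `W_ν(φ)(x) = |x|^{-ν-1} e^{sgn(x)·πi(ν+1)/2} φ(-1/x)`. -/
noncomputable def Wnu (ν : ℂ) (φ : ℝ → ℂ) (x : ℝ) : ℂ :=
  ((|x| : ℝ) : ℂ) ^ (-ν - 1) *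
    Complex.exp (((Real.sign x * Real.pi : ℝ) : ℂ) * Complex.I * (ν + 1) / 2) * φ (-1 / x)


open Filter Topology Asymptotics

/-- Smooth functions on `ℝ` whose derivatives are all rapidly decreasing at `+∞`. -/
def IsHalfSchwartz (g : ℝ → ℂ) : Prop :=
  ContDiff ℝ (⊤ : ℕ∞) g ∧ RapidlyDecreasing g

namespace IsHalfSchwartz

variable {g h : ℝ → ℂ}

theorem deriv (hg : IsHalfSchwartz g) : IsHalfSchwartz (deriv g) := by
  refine ⟨(contDiff_infty_iff_deriv.1 hg.1).2, fun m n => ?_⟩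
  obtain ⟨C, hC⟩ := hg.2 m (n + 1)
  exact ⟨C, by simpa only [iteratedDeriv_succ'] using hC⟩

theorem hasDerivAt (hg : IsHalfSchwartz g) (x : ℝ) : HasDerivAt g (_root_.deriv g x) x :=
  ((contDiff_infty_iff_deriv.1 hg.1).1 x).hasDerivAt

theorem sub (hg : IsHalfSchwartz g) (hh : IsHalfSchwartz h) :
    IsHalfSchwartz (fun x => g x - h x) := by
  refine ⟨hg.1.sub hh.1, fun m n => ?_⟩
  obtain ⟨C, hC⟩ := hg.2 m n
  obtain ⟨D, hD⟩ := hh.2 m n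
  refine ⟨C + D, fun x hx => ?_⟩
  have hn : ((n : ℕ∞) : WithTop ℕ∞) ≤ ((⊤ : ℕ∞) : WithTop ℕ∞) := by exact_mod_cast le_top
  rw [iteratedDeriv_fun_sub (hg.1.of_le hn).contDiffAt (hh.1.of_le hn).contDiffAt]
  calc x ^ m * ‖iteratedDeriv n g x - iteratedDeriv n h x‖
      ≤ x ^ m * (‖iteratedDeriv n g x‖ + ‖iteratedDeriv n h x‖) := by
        gcongr
        exact norm_sub_le _ _
    _ ≤ C + D := by
        rw [mul_add]
        exact add_le_add (hC x hx) (hD x hx)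

theorem const_mul (hg : IsHalfSchwartz g) (c : ℂ) : IsHalfSchwartz (fun x => c * g x) := by
  refine ⟨contDiff_const.mul hg.1, fun m n => ?_⟩
  obtain ⟨C, hC⟩ := hg.2 m n
  refine ⟨‖c‖ * C, fun x hx => ?_⟩
  have hn : ((n : ℕ∞) : WithTop ℕ∞) ≤ ((⊤ : ℕ∞) : WithTop ℕ∞) := by exact_mod_cast le_top
  rw [iteratedDeriv_const_mul c (hg.1.of_le hn).contDiffAt, norm_mul, mul_left_comm]
  exact mul_le_mul_of_nonneg_left (hC x hx) (norm_nonneg c)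

theorem isBigO_atTop (hg : IsHalfSchwartz g) (m : ℕ) :
    g =O[atTop] fun x : ℝ => x ^ (-(m : ℝ)) := by
  obtain ⟨C, hC⟩ := hg.2 m 0
  refine IsBigO.of_bound C ?_
  filter_upwards [eventually_ge_atTop 1] with x hx
  have hx0 : 0 < x := by linarith
  have h := hC x hx
  rw [iteratedDeriv_zero] at h
  rw [Real.rpow_neg hx0.le, Real.rpow_natCast, Real.norm_of_nonneg (by positivity),
    ← div_eq_mul_inv, le_div_iff₀ (by positivity), mul_comm]
  exact h

theorem isBigO_zero (hg : IsHalfSchwartz g) : g =O[𝓝[>] 0] fun x : ℝ => x ^ (0 : ℝ) := by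
  simpa using (hg.1.continuous.tendsto 0).isBigO_one ℝ |>.mono nhdsWithin_le_nhds

theorem isBigO_zero_of_eq_zero (hg : IsHalfSchwartz g) (h0 : g 0 = 0) :
    g =O[𝓝[>] 0] fun x : ℝ => x ^ (1 : ℝ) := by
  simpa [h0] using (hg.hasDerivAt 0).isBigO_sub.mono nhdsWithin_le_nhds

end IsHalfSchwartz

theorem hasDerivAt_cexp_neg_ofReal (x : ℝ) :
    HasDerivAt (fun t : ℝ => Complex.exp (-(t : ℂ))) (-1 * Complex.exp (-(x : ℂ))) x := by
  simpa using (Complex.ofRealCLM.hasDerivAt (x := x)).neg.cexp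

theorem iteratedDeriv_cexp_neg_ofReal (n : ℕ) :
    iteratedDeriv n (fun t : ℝ => Complex.exp (-(t : ℂ))) =
      fun t : ℝ => (-1) ^ n * Complex.exp (-(t : ℂ)) := by
  induction n with
  | zero => simp
  | succ n ih =>
    ext x
    rw [iteratedDeriv_succ, ih, ((hasDerivAt_cexp_neg_ofReal x).const_mul _).deriv]
    ring

theorem isHalfSchwartz_cexp_neg : IsHalfSchwartz (fun t : ℝ => Complex.exp (-(t : ℂ))) := by
  refine ⟨(Complex.ofRealCLM.contDiff.neg).cexp, fun m n => ⟨(m.factorial : ℝ), fun x hx => ?_⟩⟩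
  have h := Real.pow_div_factorial_le_exp x (by linarith) m
  rw [div_le_iff₀ (by positivity)] at h
  simp only [iteratedDeriv_cexp_neg_ofReal, norm_mul, norm_pow, norm_neg, norm_one, one_pow,
    one_mul, Complex.norm_exp, Complex.neg_re, Complex.ofReal_re, Real.exp_neg]
  rw [← div_eq_mul_inv, div_le_iff₀ (Real.exp_pos x), mul_comm]
  linarith

/-- The Fourier integral `∫₀^∞ x^μ g(x) e^{ixz} dx`. -/
noncomputable def halfFourier (μ : ℂ) (g : ℝ → ℂ) (z : ℝ) : ℂ :=
  ∫ x in Ioi (0 : ℝ), (x : ℂ) ^ μ * g x * Complex.exp (Complex.I * x * z)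

theorem norm_cexp_I_mul_mul (x z : ℝ) : ‖Complex.exp (Complex.I * x * z)‖ = 1 := by
  simp [Complex.norm_exp]

theorem continuous_cexp_I_mul_mul (z : ℝ) :
    Continuous fun x : ℝ => Complex.exp (Complex.I * x * z) := by fun_prop

section

variable {μ : ℂ} {g : ℝ → ℂ} {d : ℝ}

theorem integrableOn_halfFourier (hg : IsHalfSchwartz g) (hd : g =O[𝓝[>] 0] fun x : ℝ => x ^ d)
    (hμ : -1 < μ.re + d) (z : ℝ) :
    IntegrableOn (fun x : ℝ => (x : ℂ) ^ μ * g x * Complex.exp (Complex.I * x * z)) (Ioi 0) := by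
  have hO (l : Filter ℝ) :
      (fun x : ℝ => g x * Complex.exp (Complex.I * x * z)) =O[l] g :=
    IsBigO.of_bound 1 (Eventually.of_forall fun x => by rw [norm_mul, norm_cexp_I_mul_mul]; simp)
  obtain ⟨m, hm⟩ := exists_nat_gt (μ + 1).re
  have h := mellinConvergent_of_isBigO_rpow (s := μ + 1)
    ((hg.1.continuous.mul (continuous_cexp_I_mul_mul z)).locallyIntegrable.locallyIntegrableOn _)
    ((hO _).trans (hg.isBigO_atTop m)) hm ((hO _).trans (by simpa using hd) :
      _ =O[𝓝[>] 0] fun x : ℝ => x ^ (-(-d))) (by simp; linarith)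
  simpa [MellinConvergent, mul_assoc] using h

theorem tendsto_cpow_mul_atTop (hg : IsHalfSchwartz g) :
    Tendsto (fun x : ℝ => (x : ℂ) ^ μ * g x) atTop (𝓝 0) := by
  obtain ⟨m, hm⟩ := exists_nat_gt μ.re
  have h1 : (fun x : ℝ => (x : ℂ) ^ μ) =O[atTop] fun x : ℝ => x ^ μ.re := by
    refine IsBigO.of_bound 1 ?_
    filter_upwards [eventually_gt_atTop 0] with x hx
    rw [Complex.norm_cpow_eq_rpow_re_of_pos hx, one_mul]
    exact le_abs_self _
  refine ((h1.mul (hg.isBigO_atTop m)).congr' EventuallyEq.rfl ?_).trans_tendsto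
    (tendsto_rpow_neg_atTop (sub_pos.2 hm))
  filter_upwards [eventually_gt_atTop 0] with x hx
  rw [← Real.rpow_add hx]
  ring_nf

theorem tendsto_cpow_mul_zero (hd : g =O[𝓝[>] 0] fun x : ℝ => x ^ d) (hμ : 0 < μ.re + d) :
    Tendsto (fun x : ℝ => (x : ℂ) ^ μ * g x) (𝓝[>] 0) (𝓝 0) := by
  have h1 : (fun x : ℝ => (x : ℂ) ^ μ) =O[𝓝[>] 0] fun x : ℝ => x ^ μ.re := by
    refine IsBigO.of_bound 1 ?_
    filter_upwards [self_mem_nhdsWithin] with x hx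
    rw [Complex.norm_cpow_eq_rpow_re_of_pos hx, one_mul]
    exact le_abs_self _
  have h2 : Tendsto (fun x : ℝ => x ^ (μ.re + d)) (𝓝[>] 0) (𝓝 0) := by
    have := (Real.continuousAt_rpow_const 0 (μ.re + d) (Or.inr hμ.le)).tendsto
    rw [Real.zero_rpow hμ.ne'] at this
    exact this.mono_left nhdsWithin_le_nhds
  refine ((h1.mul hd).congr' EventuallyEq.rfl ?_).trans_tendsto h2
  filter_upwards [self_mem_nhdsWithin] with x hx
  rw [← Real.rpow_add hx]

theorem hasDerivAt_cexp_I_mul_mul (z x : ℝ) :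
    HasDerivAt (fun t : ℝ => Complex.exp (Complex.I * t * z))
      (Complex.I * z * Complex.exp (Complex.I * x * z)) x := by
  have := (((Complex.ofRealCLM.hasDerivAt (x := x)).const_mul Complex.I).mul_const (z : ℂ)).cexp
  refine this.congr_deriv ?_
  rw [Complex.ofRealCLM_apply, Complex.ofRealCLM_apply, Complex.ofReal_one]
  ring

/-- Integration by parts. -/
theorem mul_halfFourier (hg : IsHalfSchwartz g) (hd : g =O[𝓝[>] 0] fun x : ℝ => x ^ d)
    (hμ : 0 < μ.re + d) (hμ' : -1 < μ.re) (z : ℝ) :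
    Complex.I * z * halfFourier μ g z =
      -(μ * halfFourier (μ - 1) g z + halfFourier μ (deriv g) z) := by
  have hi0 := integrableOn_halfFourier (μ := μ - 1) hg hd (by simp; linarith) z
  have hi1 := integrableOn_halfFourier (μ := μ) hg hd (by linarith) z
  have hi2 := integrableOn_halfFourier (μ := μ) hg.deriv hg.deriv.isBigO_zero (by linarith) z
  have hsum := ((hi0.const_mul μ).add hi2).add (hi1.const_mul (Complex.I * z))
  have hbdd : ∀ (l : Filter ℝ), Tendsto (fun x : ℝ => (x : ℂ) ^ μ * g x) l (𝓝 0) →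
      Tendsto ((fun x : ℝ => (x : ℂ) ^ μ * g x) * fun x : ℝ => Complex.exp (Complex.I * x * z))
        l (𝓝 0) := by
    intro l hl
    refine squeeze_zero_norm (fun x => ?_) (tendsto_zero_iff_norm_tendsto_zero.1 hl)
    rw [Pi.mul_apply, norm_mul _ (Complex.exp _), norm_cexp_I_mul_mul, mul_one]
  have key := integral_Ioi_deriv_mul_eq_sub (a := 0) (a' := (0 : ℂ)) (b' := 0)
    (u := fun x : ℝ => (x : ℂ) ^ μ * g x) (v := fun x => Complex.exp (Complex.I * x * z))
    (u' := fun x : ℝ => μ * (x : ℂ) ^ (μ - 1) * g x + (x : ℂ) ^ μ * deriv g x)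
    (v' := fun x => Complex.I * z * Complex.exp (Complex.I * x * z))
    (fun x hx => by
      have := (Complex.hasStrictDerivAt_cpow_const (c := μ)
        (Complex.ofReal_mem_slitPlane.2 hx)).hasDerivAt.comp_ofReal
      exact this.mul (hg.hasDerivAt x))
    (fun x _ => hasDerivAt_cexp_I_mul_mul z x)
    (hsum.congr (Eventually.of_forall fun x => by simp; ring))
    (hbdd _ (tendsto_cpow_mul_zero hd hμ)) (hbdd _ (tendsto_cpow_mul_atTop hg))
  have hsplit : μ * halfFourier (μ - 1) g z + halfFourier μ (deriv g) z
      + Complex.I * z * halfFourier μ g z = 0 := by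
    rw [sub_zero] at key
    rw [← key]
    simp only [halfFourier]
    have h1 := integral_add (hi0.const_mul μ) hi2
    have h2 := integral_add ((hi0.const_mul μ).add hi2) (hi1.const_mul (Complex.I * z))
    simp only [Pi.add_apply] at h2
    rw [← integral_const_mul, ← integral_const_mul, ← h1, ← h2]
    congr 1 with x
    ring
  linear_combination hsplit

theorem hasDerivAt_halfFourier (hg : IsHalfSchwartz g) (hμ : -1 < μ.re) (z : ℝ) :
    HasDerivAt (halfFourier μ g) (Complex.I * halfFourier (μ + 1) g z) z := by
  have hO := hg.isBigO_zero
  have hi (w : ℝ) := integrableOn_halfFourier hg hO (by linarith : -1 < μ.re + 0) w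
  have hi1 (w : ℝ) := integrableOn_halfFourier (μ := μ + 1) hg hO (by simp; linarith) w
  have h := (hasDerivAt_integral_of_dominated_loc_of_deriv_le (μ := volume.restrict (Ioi 0))
    (F := fun (w x : ℝ) => (x : ℂ) ^ μ * g x * Complex.exp (Complex.I * x * w))
    (F' := fun (w x : ℝ) =>
      Complex.I * ((x : ℂ) ^ (μ + 1) * g x * Complex.exp (Complex.I * x * w)))
    (x₀ := z) (s := univ) (bound := fun x : ℝ =>
      ‖(x : ℂ) ^ (μ + 1) * g x * Complex.exp (Complex.I * x * (0 : ℝ))‖)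
    univ_mem (Eventually.of_forall fun w => (hi w).aestronglyMeasurable) (hi z)
    ((hi1 z).const_mul _).aestronglyMeasurable
    (Eventually.of_forall fun x w _ => by
      rw [norm_mul, Complex.norm_I, one_mul, norm_mul _ (Complex.exp _), norm_cexp_I_mul_mul,
        norm_mul _ (Complex.exp _), norm_cexp_I_mul_mul])
    (hi1 0).norm
    ((ae_restrict_mem measurableSet_Ioi).mono fun x hx w _ => by
      have hx' : (x : ℂ) ≠ 0 := by exact_mod_cast (ne_of_gt hx : x ≠ 0)
      have := (hasDerivAt_cexp_I_mul_mul x w).const_mul ((x : ℂ) ^ μ * g x)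
      rw [Complex.cpow_add _ _ hx', Complex.cpow_one]
      convert! this using 1
      · ext t
        ring_nf
      · ring_nf)).2
  rw [integral_const_mul] at h
  exact h

theorem contDiff_halfFourier (hg : IsHalfSchwartz g) (hμ : -1 < μ.re) :
    ContDiff ℝ (⊤ : ℕ∞) (halfFourier μ g) := by
  refine contDiff_infty.2 fun n => ?_
  induction n generalizing μ with
  | zero =>
    exact contDiff_zero.2
      (continuous_iff_continuousAt.2 fun z => (hasDerivAt_halfFourier hg hμ z).continuousAt)
  | succ n ih =>
    have hd := hasDerivAt_halfFourier hg hμ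
    push_cast
    refine contDiff_succ_iff_deriv.2 ⟨fun z => (hd z).differentiableAt, by simp, ?_⟩
    rw [funext fun z => (hd z).deriv]
    exact contDiff_const.mul (ih (by simp; linarith))

/-- The Riemann-Lebesgue lemma. -/
theorem tendsto_halfFourier_cocompact (μ : ℂ) (g : ℝ → ℂ) :
    Tendsto (halfFourier μ g) (cocompact ℝ) (𝓝 0) := by
  have h := Real.tendsto_integral_exp_smul_cocompact
    ((Ioi (0 : ℝ)).indicator fun x : ℝ => (x : ℂ) ^ μ * g x)
  have hc : Tendsto (fun z : ℝ => z * (-(2 * Real.pi))⁻¹) (cocompact ℝ) (cocompact ℝ) :=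
    (Homeomorph.mulRight₀ (-(2 * Real.pi))⁻¹
      (inv_ne_zero (neg_ne_zero.2 (by positivity)))).isClosedEmbedding.tendsto_cocompact
  refine (h.comp hc).congr fun z => ?_
  rw [halfFourier, ← integral_indicator measurableSet_Ioi, Function.comp_apply]
  congr 1 with x
  by_cases hx : x ∈ Ioi (0 : ℝ)
  · rw [indicator_of_mem hx, indicator_of_mem hx, Circle.smul_def, Real.fourierChar_apply,
      smul_eq_mul, mul_comm]
    congr 2
    have : (Real.pi : ℂ) ≠ 0 := by exact_mod_cast Real.pi_ne_zero
    push_cast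
    field_simp
  · rw [indicator_of_notMem hx, indicator_of_notMem hx, smul_zero]

theorem tendsto_pow_succ_mul_halfFourier {k : ℕ} (hg : IsHalfSchwartz g)
    (hd : g =O[𝓝[>] 0] fun x : ℝ => x ^ d) (hμ : 0 < μ.re + d) (hμ' : -1 < μ.re)
    (h1 : Tendsto (fun z : ℝ => (z : ℂ) ^ k * halfFourier (μ - 1) g z) (cocompact ℝ) (𝓝 0))
    (h2 : Tendsto (fun z : ℝ => (z : ℂ) ^ k * halfFourier μ (deriv g) z) (cocompact ℝ) (𝓝 0)) :
    Tendsto (fun z : ℝ => (z : ℂ) ^ (k + 1) * halfFourier μ g z) (cocompact ℝ) (𝓝 0) := by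
  have h := ((h1.const_mul μ).add h2).const_mul Complex.I
  simp only [mul_zero, add_zero] at h
  refine h.congr fun z => ?_
  linear_combination (Complex.I * (z : ℂ) ^ k) * mul_halfFourier hg hd hμ hμ' z
    - (z : ℂ) ^ (k + 1) * halfFourier μ g z * Complex.I_sq

theorem tendsto_pow_mul_halfFourier {k : ℕ} (hg : IsHalfSchwartz g) (hμ : (k : ℝ) - 1 < μ.re) :
    Tendsto (fun z : ℝ => (z : ℂ) ^ k * halfFourier μ g z) (cocompact ℝ) (𝓝 0) := by
  induction k generalizing μ g with
  | zero => simpa using tendsto_halfFourier_cocompact μ g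
  | succ k ih =>
    push_cast at hμ
    have hk : (0 : ℝ) ≤ k := k.cast_nonneg
    refine tendsto_pow_succ_mul_halfFourier hg hg.isBigO_zero (by linarith) (by linarith)
      (ih hg (by simp; linarith)) (ih hg.deriv (by linarith))

theorem tendsto_pow_mul_halfFourier_of_eq_zero {k : ℕ} (hg : IsHalfSchwartz g) (h0 : g 0 = 0)
    (hμ : (k : ℝ) - 2 < μ.re) :
    Tendsto (fun z : ℝ => (z : ℂ) ^ k * halfFourier μ g z) (cocompact ℝ) (𝓝 0) := by
  induction k generalizing μ with
  | zero => simpa using tendsto_halfFourier_cocompact μ g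
  | succ k ih =>
    push_cast at hμ
    have hk : (0 : ℝ) ≤ k := k.cast_nonneg
    exact tendsto_pow_succ_mul_halfFourier hg (hg.isBigO_zero_of_eq_zero h0) (by linarith)
      (by linarith) (ih (by simp; linarith)) (tendsto_pow_mul_halfFourier hg.deriv (by linarith))

end

theorem one_sub_I_mul_mem_slitPlane (z : ℝ) : 1 - Complex.I * z ∈ Complex.slitPlane :=
  Or.inl (by simp)

theorem mul_halfFourier_cexp_neg {ν : ℂ} (hν : -1 < ν.re) (z : ℝ) :
    (1 - Complex.I * z) * halfFourier (ν + 1) (fun t : ℝ => Complex.exp (-(t : ℂ))) z =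
      (ν + 1) * halfFourier ν (fun t : ℝ => Complex.exp (-(t : ℂ))) z := by
  have h := mul_halfFourier (μ := ν + 1) isHalfSchwartz_cexp_neg
    isHalfSchwartz_cexp_neg.isBigO_zero (by simp; linarith) (by simp; linarith) z
  have hd : halfFourier (ν + 1) (deriv fun t : ℝ => Complex.exp (-(t : ℂ))) z =
      -halfFourier (ν + 1) (fun t : ℝ => Complex.exp (-(t : ℂ))) z := by
    rw [funext fun t => (hasDerivAt_cexp_neg_ofReal t).deriv, halfFourier, halfFourier,
      ← integral_neg]
    congr 1 with x
    ring
  rw [hd, add_sub_cancel_right] at h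
  linear_combination -h

theorem halfFourier_cexp_neg {ν : ℂ} (hν : -1 < ν.re) (z : ℝ) :
    halfFourier ν (fun t : ℝ => Complex.exp (-(t : ℂ))) z =
      halfFourier ν (fun t : ℝ => Complex.exp (-(t : ℂ))) 0 *
        ((1 - Complex.I * z) ^ (ν + 1))⁻¹ := by
  have hderiv (w : ℝ) : HasDerivAt (fun w : ℝ => halfFourier ν
      (fun t : ℝ => Complex.exp (-(t : ℂ))) w * (1 - Complex.I * w) ^ (ν + 1)) 0 w := by
    have hlin : HasDerivAt (fun w : ℝ => 1 - Complex.I * (w : ℂ)) (-Complex.I) w := by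
      simpa using ((Complex.ofRealCLM.hasDerivAt (x := w)).const_mul Complex.I).const_sub 1
    have hpow := (Complex.hasStrictDerivAt_cpow_const (c := ν + 1)
      (one_sub_I_mul_mem_slitPlane w)).hasDerivAt.comp w hlin
    refine ((hasDerivAt_halfFourier isHalfSchwartz_cexp_neg hν w).mul hpow).congr_deriv ?_
    have h0 := Complex.slitPlane_ne_zero (one_sub_I_mul_mem_slitPlane w)
    rw [Function.comp_apply, add_sub_cancel_right, Complex.cpow_add _ _ h0, Complex.cpow_one]
    linear_combination
      (Complex.I * (1 - Complex.I * (w : ℂ)) ^ ν) * mul_halfFourier_cexp_neg hν w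
  have hconst := is_const_of_deriv_eq_zero (fun w => (hderiv w).differentiableAt)
    (fun w => (hderiv w).deriv) z 0
  have hne : (1 - Complex.I * (z : ℂ)) ^ (ν + 1) ≠ 0 := by
    simp [Complex.cpow_eq_zero_iff, Complex.slitPlane_ne_zero (one_sub_I_mul_mem_slitPlane z)]
  rw [eq_mul_inv_iff_mul_eq₀ hne]
  simpa using hconst

theorem I_div_mem_slitPlane {x : ℝ} (hx : x ≠ 0) : Complex.I / (x : ℂ) ∈ Complex.slitPlane := by
  refine Or.inr ?_
  rw [Complex.div_ofReal_im, Complex.I_im]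
  positivity

theorem I_div_cpow_mul_one_sub_I_mul_cpow {x : ℝ} (hx : x ≠ 0) (s : ℂ) :
    (Complex.I / (x : ℂ)) ^ s * (1 - Complex.I * x) ^ s = (1 + Complex.I / (x : ℂ)) ^ s := by
  have h1 := Complex.slitPlane_ne_zero (I_div_mem_slitPlane hx)
  have h2 := Complex.slitPlane_ne_zero (one_sub_I_mul_mem_slitPlane x)
  have ha1 : |(Complex.I / (x : ℂ)).arg| ≤ Real.pi / 2 :=
    Complex.abs_arg_le_pi_div_two_iff.2 (by simp [Complex.div_ofReal_re])
  have ha2 : |(1 - Complex.I * (x : ℂ)).arg| < Real.pi / 2 :=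
    Complex.abs_arg_lt_pi_div_two_iff.2 (Or.inl (by simp))
  rw [abs_le] at ha1
  rw [abs_lt] at ha2
  have hprod : Complex.I / (x : ℂ) * (1 - Complex.I * x) = 1 + Complex.I / (x : ℂ) := by
    have : (x : ℂ) ≠ 0 := by exact_mod_cast hx
    field_simp
    linear_combination (-(x : ℂ)) * Complex.I_sq
  rw [← hprod, Complex.cpow_def_of_ne_zero h1, Complex.cpow_def_of_ne_zero h2,
    Complex.cpow_def_of_ne_zero (mul_ne_zero h1 h2),
    Complex.log_mul h1 h2 ⟨by linarith, by linarith⟩, ← Complex.exp_add]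
  ring_nf

/-- The smooth extension of `x ↦ (i/x)^{ν+1} ∫₀^∞ t^ν g(t) e^{-it/x} dt` to `x = 0`. -/
noncomputable def invertedFourier (ν : ℂ) (g : ℝ → ℂ) (x : ℝ) : ℂ :=
  if x = 0 then g 0 * halfFourier ν (fun t : ℝ => Complex.exp (-(t : ℂ))) 0
  else (Complex.I / (x : ℂ)) ^ (ν + 1) * halfFourier ν g (-1 / x)

theorem invertedFourier_of_ne_zero (ν : ℂ) (g : ℝ → ℂ) {x : ℝ} (hx : x ≠ 0) :
    invertedFourier ν g x = (Complex.I / (x : ℂ)) ^ (ν + 1) * halfFourier ν g (-1 / x) :=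
  if_neg hx

section

variable {ν : ℂ} {g : ℝ → ℂ}

theorem hasDerivAt_invertedFourier_of_ne_zero (hg : IsHalfSchwartz g) (hν : -1 < ν.re) {x : ℝ}
    (hx : x ≠ 0) :
    HasDerivAt (invertedFourier ν g) (-Complex.I * invertedFourier (ν + 1) (deriv g) x) x := by
  have hxC : (x : ℂ) ≠ 0 := by exact_mod_cast hx
  have hI : HasDerivAt (fun y : ℝ => Complex.I / (y : ℂ)) (-Complex.I / (x : ℂ) ^ 2) x := by
    have := ((hasDerivAt_inv hxC).comp_ofReal).const_mul Complex.I
    refine (this.congr_deriv ?_).congr_of_eventuallyEq ?_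
    · field_simp
    · exact Eventually.of_forall fun y => div_eq_mul_inv _ _
  have hpow := (Complex.hasStrictDerivAt_cpow_const (c := ν + 1)
    (I_div_mem_slitPlane hx)).hasDerivAt.comp x hI
  have hinv : HasDerivAt (fun y : ℝ => -1 / y) (1 / x ^ 2) x := by
    have := (hasDerivAt_inv hx).neg
    refine (this.congr_deriv ?_).congr_of_eventuallyEq ?_
    · field_simp
    · exact Eventually.of_forall fun y => by simp [neg_div]
  have hF := (hasDerivAt_halfFourier hg hν (-1 / x)).scomp x hinv
  refine ((hpow.mul hF).congr_deriv ?_).congr_of_eventuallyEq ?_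
  · have hparts := mul_halfFourier (μ := ν + 1) hg hg.isBigO_zero (by simp; linarith)
      (by simp; linarith) (-1 / x)
    simp only [Function.comp_apply]
    rw [invertedFourier_of_ne_zero _ _ hx, add_sub_cancel_right,
      Complex.cpow_add (ν + 1) 1 (Complex.slitPlane_ne_zero (I_div_mem_slitPlane hx)),
      Complex.cpow_add ν 1 (Complex.slitPlane_ne_zero (I_div_mem_slitPlane hx)),
      Complex.cpow_one, Complex.real_smul]
    rw [add_sub_cancel_right] at hparts
    push_cast at hparts ⊢
    generalize (Complex.I / (x : ℂ)) ^ ν = P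
    generalize halfFourier ν g (-1 / x) = A at *
    generalize halfFourier (ν + 1) g (-1 / x) = B at *
    generalize halfFourier (ν + 1) (deriv g) (-1 / x) = C at *
    have hC : C = -((ν + 1) * A) + Complex.I / x * B := by
      linear_combination hparts
    rw [hC]
    field_simp
    ring_nf
    simp only [Complex.I_sq, Complex.I_pow_three]
    ring_nf
  · filter_upwards [eventually_ne_nhds hx] with y hy
    exact invertedFourier_of_ne_zero _ _ hy

theorem isBigO_I_div_cpow {s : ℂ} {k : ℕ} (hk : s.re ≤ k) :
    (fun x : ℝ => (Complex.I / (x : ℂ)) ^ s) =O[𝓝[≠] 0] fun x : ℝ => ((-1 / x : ℝ) : ℂ) ^ k := by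
  refine IsBigO.of_bound (Real.exp (Real.pi * |s.im|)) ?_
  have h1 : ∀ᶠ x : ℝ in 𝓝[≠] 0, |x| < 1 :=
    nhdsWithin_le_nhds (by
      filter_upwards [Metric.ball_mem_nhds (0 : ℝ) one_pos] with x hx
      simpa using hx)
  filter_upwards [h1, self_mem_nhdsWithin] with x hx1 hx0
  have hx : 0 < |x| := abs_pos.2 hx0
  have hnorm : ‖Complex.I / (x : ℂ)‖ = |x|⁻¹ := by simp
  have hexp : (Real.exp ((Complex.I / (x : ℂ)).arg * s.im))⁻¹ ≤ Real.exp (Real.pi * |s.im|) := by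
    rw [← Real.exp_neg, Real.exp_le_exp]
    refine (neg_le_abs _).trans ?_
    rw [abs_mul]
    exact mul_le_mul_of_nonneg_right (Complex.abs_arg_le_pi _) (abs_nonneg _)
  calc ‖(Complex.I / (x : ℂ)) ^ s‖
      ≤ ‖Complex.I / (x : ℂ)‖ ^ s.re / Real.exp ((Complex.I / (x : ℂ)).arg * s.im) :=
        Complex.norm_cpow_le _ _
    _ ≤ |x|⁻¹ ^ k * Real.exp (Real.pi * |s.im|) := by
        rw [div_eq_mul_inv, hnorm, ← Real.rpow_natCast]
        gcongr
        exact (one_le_inv₀ hx).2 hx1.le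
    _ = Real.exp (Real.pi * |s.im|) * ‖((-1 / x : ℝ) : ℂ) ^ k‖ := by
        rw [mul_comm]
        simp

theorem tendsto_neg_one_div_cocompact :
    Tendsto (fun x : ℝ => -1 / x) (𝓝[≠] 0) (cocompact ℝ) := by
  rw [← Metric.cobounded_eq_cocompact]
  refine (tendsto_neg_cobounded.comp tendsto_inv₀_nhdsNE_zero).congr fun x => ?_
  simp [neg_div]

theorem continuousAt_invertedFourier_zero (hg : IsHalfSchwartz g) (hν : -1 < ν.re) :
    ContinuousAt (invertedFourier ν g) 0 := by
  set e : ℝ → ℂ := fun t : ℝ => Complex.exp (-(t : ℂ)) with he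
  set u : ℝ → ℂ := fun t => g t - g 0 * e t with hu
  have hge : IsHalfSchwartz (fun t => g 0 * e t) := isHalfSchwartz_cexp_neg.const_mul _
  have hu' : IsHalfSchwartz u := hg.sub hge
  have hu0 : u 0 = 0 := by simp [hu, he]
  have hsplit (z : ℝ) : halfFourier ν g z = g 0 * halfFourier ν e z + halfFourier ν u z := by
    have h1 := integrableOn_halfFourier isHalfSchwartz_cexp_neg
      isHalfSchwartz_cexp_neg.isBigO_zero (by linarith : -1 < ν.re + 0) z
    have h2 := integrableOn_halfFourier hu' hu'.isBigO_zero (by linarith : -1 < ν.re + 0) z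
    rw [halfFourier, halfFourier, halfFourier, ← integral_const_mul,
      ← integral_add (h1.const_mul _) h2]
    congr 1 with x
    simp only [hu, he]
    ring
  have hk : (ν + 1).re ≤ (⌈(ν + 1).re⌉₊ : ℝ) := Nat.le_ceil _
  have hk' : ((⌈(ν + 1).re⌉₊ : ℕ) : ℝ) - 2 < ν.re := by
    have := Nat.ceil_lt_add_one (a := (ν + 1).re) (by simp; linarith)
    have h1 : (ν + 1).re = ν.re + 1 := by simp
    linarith
  have hlim_u : Tendsto (fun x : ℝ => (Complex.I / (x : ℂ)) ^ (ν + 1) * halfFourier ν u (-1 / x))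
      (𝓝[≠] 0) (𝓝 0) :=
    ((isBigO_I_div_cpow hk).mul (isBigO_refl _ _)).trans_tendsto
      ((tendsto_pow_mul_halfFourier_of_eq_zero hu' hu0 hk').comp tendsto_neg_one_div_cocompact)
  have hlim_e : Tendsto (fun x : ℝ => g 0 * (halfFourier ν e 0 *
      ((1 - Complex.I * (x : ℂ)) ^ (-(ν + 1))))) (𝓝[≠] 0) (𝓝 (g 0 * halfFourier ν e 0)) := by
    have hc : ContinuousAt (fun x : ℝ => (1 - Complex.I * (x : ℂ)) ^ (-(ν + 1))) 0 :=
      ContinuousAt.cpow (by fun_prop) continuousAt_const (one_sub_I_mul_mem_slitPlane 0)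
    have := ((hc.tendsto.const_mul (halfFourier ν e 0)).const_mul (g 0)).mono_left
      (nhdsWithin_le_nhds (s := {0}ᶜ))
    simpa using this
  refine continuousAt_iff_punctured_nhds.2 ?_
  have h0 : invertedFourier ν g 0 = g 0 * halfFourier ν e 0 + 0 := by
    rw [add_zero]
    exact if_pos rfl
  rw [h0]
  refine (hlim_e.add hlim_u).congr' ?_
  filter_upwards [self_mem_nhdsWithin] with x hx
  have hmul := I_div_cpow_mul_one_sub_I_mul_cpow hx (ν + 1)
  have hI : (Complex.I / (x : ℂ)) ^ (ν + 1) ≠ 0 := by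
    simp [Complex.cpow_eq_zero_iff, Complex.slitPlane_ne_zero (I_div_mem_slitPlane hx)]
  have harg : 1 - Complex.I * ((-1 / x : ℝ) : ℂ) = 1 + Complex.I / x := by
    push_cast
    ring
  rw [invertedFourier_of_ne_zero _ _ hx, hsplit, he, halfFourier_cexp_neg hν (-1 / x), harg, ← hmul,
    Complex.cpow_neg, mul_inv]
  field_simp

theorem hasDerivAt_invertedFourier (hg : IsHalfSchwartz g) (hν : -1 < ν.re) (x : ℝ) :
    HasDerivAt (invertedFourier ν g) (-Complex.I * invertedFourier (ν + 1) (deriv g) x) x :=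
  hasDerivAt_of_hasDerivAt_of_ne'
    (fun _ hy => hasDerivAt_invertedFourier_of_ne_zero hg hν hy)
    (continuousAt_invertedFourier_zero hg hν)
    (continuousAt_const.mul (continuousAt_invertedFourier_zero hg.deriv (by simp; linarith))) x

theorem contDiff_invertedFourier (hg : IsHalfSchwartz g) (hν : -1 < ν.re) :
    ContDiff ℝ (⊤ : ℕ∞) (invertedFourier ν g) := by
  refine contDiff_infty.2 fun n => ?_
  induction n generalizing ν g with
  | zero =>
    exact contDiff_zero.2
      (continuous_iff_continuousAt.2 fun x => (hasDerivAt_invertedFourier hg hν x).continuousAt)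
  | succ n ih =>
    have hd := hasDerivAt_invertedFourier hg hν
    push_cast
    refine contDiff_succ_iff_deriv.2 ⟨fun x => (hd x).differentiableAt, by simp, ?_⟩
    rw [funext fun x => (hd x).deriv]
    exact contDiff_const.mul (ih hg.deriv (by simp; linarith))

end

theorem Tnu_eq_halfFourier {ν : ℂ} {f f₁ g : ℝ → ℂ}
    (hf : ∀ x : ℝ, 0 ≤ x → f x = (x : ℂ) ^ ((ν + 1) / 2) * f₁ x)
    (hg : ∀ x : ℝ, 0 ≤ x → f₁ x = g x) (z : ℝ) :
    Tnu ν f z = (((2 * Real.pi) ^ (-(1 : ℝ) / 2) : ℝ) : ℂ) * halfFourier ν g z := by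
  rw [Tnu, halfFourier]
  congr 1
  refine setIntegral_congr_fun measurableSet_Ioi fun x hx => ?_
  have hx0 : (0 : ℝ) < x := hx
  have hxC : (x : ℂ) ≠ 0 := by exact_mod_cast hx0.ne'
  simp only [hf x hx0.le, hg x hx0.le]
  rw [← mul_assoc ((x : ℂ) ^ ((ν - 1) / 2)), ← Complex.cpow_add _ _ hxC]
  ring_nf

theorem abs_cpow_mul_cexp_sign_eq_I_div_cpow (ν : ℂ) {x : ℝ} (hx : x ≠ 0) :
    ((|x| : ℝ) : ℂ) ^ (-ν - 1) *
      Complex.exp (((Real.sign x * Real.pi : ℝ) : ℂ) * Complex.I * (ν + 1) / 2) =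
      (Complex.I / (x : ℂ)) ^ (ν + 1) := by
  have hxC : (x : ℂ) ≠ 0 := by exact_mod_cast hx
  have habs : 0 < |x| := abs_pos.2 hx
  rw [Complex.cpow_def_of_ne_zero (by exact_mod_cast habs.ne'),
    Complex.cpow_def_of_ne_zero (Complex.slitPlane_ne_zero (I_div_mem_slitPlane hx)),
    ← Complex.exp_add, ← Complex.ofReal_log habs.le]
  congr 1
  rcases lt_or_gt_of_ne hx with h | h
  · have hI : Complex.I / (x : ℂ) = ((|x|⁻¹ : ℝ) : ℂ) * -Complex.I := by
      rw [abs_of_neg h]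
      push_cast
      field_simp
    rw [hI, Complex.log_ofReal_mul (inv_pos.2 habs) (neg_ne_zero.2 Complex.I_ne_zero),
      Complex.log_neg_I, Real.log_inv, Real.sign_of_neg h]
    push_cast
    ring
  · have hI : Complex.I / (x : ℂ) = ((|x|⁻¹ : ℝ) : ℂ) * Complex.I := by
      rw [abs_of_pos h]
      push_cast
      field_simp
    rw [hI, Complex.log_ofReal_mul (inv_pos.2 habs) Complex.I_ne_zero,
      Complex.log_I, Real.log_inv, Real.sign_of_pos h]
    push_cast
    ring

/-- for `Re ν > -1` and `f ∈ S_ν([0,∞))`, `T_ν(f)` is smooth on `ℝ` and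
`W_ν(T_ν(f))` (defined for `x ≠ 0`) extends to a smooth function on `ℝ`. -/
theorem Tnu_maps_into_Inu (ν : ℂ) (hν : -1 < ν.re) (f : ℝ → ℂ) (hf : MemSnu ν f) :
    ContDiff ℝ (⊤ : ℕ∞) (Tnu ν f) ∧
      ∃ g : ℝ → ℂ, ContDiff ℝ (⊤ : ℕ∞) g ∧ ∀ x : ℝ, x ≠ 0 → g x = Wnu ν (Tnu ν f) x := by
  obtain ⟨f₁, ⟨g, hgs, hfg, hgd⟩, hf⟩ := hf
  have hg : IsHalfSchwartz g := ⟨hgs, hgd⟩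
  have hT := Tnu_eq_halfFourier hf hfg
  refine ⟨?_, fun x => (((2 * Real.pi) ^ (-(1 : ℝ) / 2) : ℝ) : ℂ) * invertedFourier ν g x,
    contDiff_const.mul (contDiff_invertedFourier hg hν), fun x hx => ?_⟩
  · rw [funext hT]
    exact contDiff_const.mul (contDiff_halfFourier hg hν)
  · beta_reduce
    rw [Wnu, hT, abs_cpow_mul_cexp_sign_eq_I_div_cpow ν hx, invertedFourier_of_ne_zero _ _ hx]
    ring
end

section
/- L² isometry of the Hankel transform: let ν be real with ν > −1 and let f₁, f₂ ∈ S_ν([0,∞)). Then ⟨H_ν(f₁), H_ν(f₂)⟩ = ⟨f₁, f₂⟩, where ⟨f₁, f₂⟩ = ∫₀^∞ f₁(x) conj(f₂(x)) dx/x. -/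
open MeasureTheory Set

/-- The entire function `t ↦ t^(-ν/2) J_ν(2√t)`, given by its power series. -/
noncomputable def besselEntire (ν t : ℝ) : ℝ :=
  ∑' k : ℕ, (-t) ^ k / (k.factorial * Real.Gamma (k + ν + 1))

theorem exists_pos_le_Gamma_nat_add {ν : ℝ} (hν : -1 < ν) :
    ∃ m : ℝ, 0 < m ∧ ∀ k : ℕ, m ≤ Real.Gamma (k + ν + 1) := by
  refine ⟨min (Real.Gamma (ν + 1)) (Real.Gamma (ν + 2)),
    lt_min (Real.Gamma_pos_of_pos (by linarith)) (Real.Gamma_pos_of_pos (by linarith)), ?_⟩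
  have key : ∀ k : ℕ, Real.Gamma (ν + 2) ≤ Real.Gamma ((k + 1 : ℕ) + ν + 1) := by
    intro k
    induction k with
    | zero => apply le_of_eq; congr 1; push_cast; ring
    | succ k ih =>
      have hpos : (0 : ℝ) < (k + 1 : ℕ) + ν + 1 := by
        push_cast; have := k.cast_nonneg (α := ℝ); linarith
      have h := Real.Gamma_add_one hpos.ne'
      have e : ((k + 1 + 1 : ℕ) : ℝ) + ν + 1 = ((k + 1 : ℕ) : ℝ) + ν + 1 + 1 := by push_cast; ring
      rw [e, h]
      refine ih.trans (le_mul_of_one_le_left (Real.Gamma_pos_of_pos hpos).le ?_)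
      push_cast; have := k.cast_nonneg (α := ℝ); linarith
  intro k
  cases k with
  | zero => exact (min_le_left _ _).trans (by simp)
  | succ k => exact (min_le_right _ _).trans (key k)

theorem Gamma_nat_add_pos {ν : ℝ} (hν : -1 < ν) (k : ℕ) : 0 < Real.Gamma (k + ν + 1) :=
  Real.Gamma_pos_of_pos (by have := k.cast_nonneg (α := ℝ); linarith)

theorem summable_besselEntire_term {ν : ℝ} (hν : -1 < ν) (t : ℝ) :
    Summable fun k : ℕ ↦ (-t) ^ k / (k.factorial * Real.Gamma (k + ν + 1)) := by
  obtain ⟨m, hm, hle⟩ := exists_pos_le_Gamma_nat_add hν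
  refine Summable.of_norm_bounded ((Real.summable_pow_div_factorial |t|).mul_right m⁻¹) fun k ↦ ?_
  have hΓ := Gamma_nat_add_pos hν k
  rw [Real.norm_eq_abs, abs_div, abs_pow, abs_neg, abs_of_pos (mul_pos (by positivity) hΓ),
    ← div_div, ← div_eq_mul_inv]
  gcongr
  exact hle k

theorem hasSum_besselEntire {ν : ℝ} (hν : -1 < ν) (t : ℝ) :
    HasSum (fun k : ℕ ↦ (-t) ^ k / (k.factorial * Real.Gamma (k + ν + 1))) (besselEntire ν t) :=
  (summable_besselEntire_term hν t).hasSum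

theorem besselEntire_deriv_term (ν t : ℝ) (k : ℕ) :
    ((k + 1 : ℕ) * (-t) ^ k * -1) / ((k + 1).factorial * Real.Gamma ((k + 1 : ℕ) + ν + 1)) =
      -((-t) ^ k / (k.factorial * Real.Gamma (k + (ν + 1) + 1))) := by
  have e : (k + 1 : ℕ) + ν + 1 = (k + (ν + 1) + 1 : ℝ) := by push_cast; ring
  rw [e, Nat.factorial_succ, Nat.cast_mul, mul_assoc, mul_assoc,
    mul_div_mul_left _ _ (by positivity : ((k + 1 : ℕ) : ℝ) ≠ 0)]
  ring

theorem hasDerivAt_besselEntire {ν : ℝ} (hν : -1 < ν) (t : ℝ) :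
    HasDerivAt (besselEntire ν) (-besselEntire (ν + 1) t) t := by
  obtain ⟨m, hm, hle⟩ := exists_pos_le_Gamma_nat_add hν
  set R : ℝ := |t| + 1 with hR
  have hR0 : 0 ≤ R := by positivity
  have hu : Summable fun k : ℕ ↦ (k * R ^ (k - 1) / k.factorial) * m⁻¹ := by
    refine Summable.mul_right _ ((summable_nat_add_iff 1).1 ?_)
    refine (Real.summable_pow_div_factorial R).congr fun k ↦ ?_
    rw [Nat.factorial_succ, Nat.cast_mul, Nat.add_sub_cancel,
      mul_div_mul_left _ _ (by positivity : ((k + 1 : ℕ) : ℝ) ≠ 0)]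
  have h := hasDerivAt_tsum_of_isPreconnected (𝕜 := ℝ)
    (g := fun (k : ℕ) (x : ℝ) ↦ (-x) ^ k / (k.factorial * Real.Gamma (k + ν + 1)))
    (g' := fun (k : ℕ) (x : ℝ) ↦ (k * (-x) ^ (k - 1) * -1) /
      (k.factorial * Real.Gamma (k + ν + 1)))
    (t := Metric.ball 0 R) (y₀ := 0) (y := t) hu Metric.isOpen_ball
    (convex_ball 0 R).isPreconnected
    (fun k x _ ↦ (((hasDerivAt_neg x).pow k).div_const _))
    (fun k x hx ↦ by
      have hΓ := Gamma_nat_add_pos hν k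
      have hx' : |x| ≤ R := by
        rw [Metric.mem_ball, dist_zero_right] at hx; exact hx.le
      rw [Real.norm_eq_abs, abs_div, abs_of_pos (mul_pos (by positivity) hΓ), abs_mul, abs_mul,
        abs_pow, abs_neg, abs_neg, abs_one, mul_one, Nat.abs_cast, ← div_div, ← div_eq_mul_inv]
      gcongr
      exact hle k)
    (by rw [Metric.mem_ball, dist_self]; positivity)
    (summable_besselEntire_term hν 0)
    (by rw [Metric.mem_ball, dist_zero_right, Real.norm_eq_abs]; linarith)
  refine h.congr_deriv ?_
  have h1 : HasSum (fun k : ℕ ↦ ((k + 1 : ℕ) * (-t) ^ (k + 1 - 1) * -1) /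
      ((k + 1).factorial * Real.Gamma ((k + 1 : ℕ) + ν + 1))) (-besselEntire (ν + 1) t) := by
    simp only [Nat.add_sub_cancel, besselEntire_deriv_term]
    exact (hasSum_besselEntire (by linarith) t).neg
  have h2 := (hasSum_nat_add_iff (f := fun k : ℕ ↦ (k * (-t) ^ (k - 1) * -1) /
    (k.factorial * Real.Gamma (k + ν + 1))) 1).1 h1
  simpa using h2.tsum_eq

theorem continuous_besselEntire {ν : ℝ} (hν : -1 < ν) : Continuous (besselEntire ν) :=
  continuous_iff_continuousAt.2 fun t ↦ (hasDerivAt_besselEntire hν t).continuousAt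

theorem besselEntire_recurrence {ν : ℝ} (hν : -1 < ν) (t : ℝ) :
    besselEntire ν t = (ν + 1) * besselEntire (ν + 1) t - t * besselEntire (ν + 2) t := by
  have h1 := (hasSum_besselEntire hν t).sub
    ((hasSum_besselEntire (ν := ν + 1) (by linarith) t).mul_left (ν + 1))
  have h2 : HasSum (fun k : ℕ ↦ (k + 1 : ℕ) * ((-t) ^ (k + 1) /
      ((k + 1).factorial * Real.Gamma ((k + 1 : ℕ) + (ν + 1) + 1))))
      (-t * besselEntire (ν + 2) t) := by
    refine ((hasSum_besselEntire (ν := ν + 2) (by linarith) t).mul_left (-t)).congr_fun fun k ↦ ?_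
    have e : ((k + 1 : ℕ) : ℝ) + (ν + 1) + 1 = k + (ν + 2) + 1 := by push_cast; ring
    rw [e, Nat.factorial_succ, Nat.cast_mul, ← mul_div_assoc, mul_assoc,
      mul_div_mul_left _ _ (by positivity : ((k + 1 : ℕ) : ℝ) ≠ 0), pow_succ]
    ring
  have h3 := (hasSum_nat_add_iff (f := fun k : ℕ ↦ (k : ℝ) * ((-t) ^ k /
      (k.factorial * Real.Gamma (k + (ν + 1) + 1)))) 1).1 h2
  have h4 := h1.unique (h3.congr_fun ?_)
  · simp at h4; linarith
  intro k
  have hpos : (0 : ℝ) < k + ν + 1 := by have := k.cast_nonneg (α := ℝ); linarith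
  have e : (k + (ν + 1) + 1 : ℝ) = k + ν + 1 + 1 := by ring
  have hΓ := (Gamma_nat_add_pos hν k).ne'
  rw [e, Real.Gamma_add_one hpos.ne']
  field_simp
  ring

theorem abs_besselEntire_le {ν : ℝ} (hν : -1 / 2 ≤ ν) {t : ℝ} (ht : 0 ≤ t) :
    |besselEntire ν t| ≤ |besselEntire ν 0| := by
  have hd : ∀ s, HasDerivAt (fun s ↦ s * besselEntire (ν + 1) s ^ 2 + besselEntire ν s ^ 2)
      (-(2 * ν + 1) * besselEntire (ν + 1) s ^ 2) s := by
    intro s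
    have h0 := hasDerivAt_besselEntire (ν := ν) (by linarith) s
    have h1 := hasDerivAt_besselEntire (ν := ν + 1) (by linarith) s
    refine (((hasDerivAt_id s).mul (h1.pow 2)).add (h0.pow 2)).congr_deriv ?_
    have hr := besselEntire_recurrence (ν := ν) (by linarith) s
    rw [show ν + 1 + 1 = ν + 2 by ring]
    simp only [id, Nat.cast_ofNat, Pi.pow_apply]
    rw [hr]; ring
  have hanti := antitone_of_hasDerivAt_nonpos hd fun s ↦
    mul_nonpos_of_nonpos_of_nonneg (by linarith) (sq_nonneg (besselEntire (ν + 1) s))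
  have := hanti ht
  simp only [zero_mul, zero_add] at this
  refine sq_le_sq.1 (le_trans ?_ this)
  have := mul_nonneg ht (sq_nonneg (besselEntire (ν + 1) t))
  linarith

theorem exists_abs_besselEntire_le {ν : ℝ} (hν : -1 < ν) :
    ∃ C : ℝ, 0 ≤ C ∧ ∀ t, 0 ≤ t → |besselEntire ν t| ≤ C * (1 + t) := by
  refine ⟨(ν + 1) * |besselEntire (ν + 1) 0| + |besselEntire (ν + 2) 0|,
    add_nonneg (mul_nonneg (by linarith) (abs_nonneg _)) (abs_nonneg _), fun t ht ↦ ?_⟩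
  have h1 := abs_besselEntire_le (ν := ν + 1) (by linarith) ht
  have h2 := abs_besselEntire_le (ν := ν + 2) (by linarith) ht
  rw [besselEntire_recurrence hν]
  refine (abs_sub _ _).trans ?_
  rw [abs_mul, abs_mul, abs_of_nonneg ht, abs_of_nonneg (by linarith : 0 ≤ ν + 1)]
  have h3 := mul_le_mul_of_nonneg_left h1 (by linarith : 0 ≤ ν + 1)
  have h4 := mul_le_mul_of_nonneg_left h2 ht
  have h5 := mul_nonneg (by linarith : 0 ≤ ν + 1) (abs_nonneg (besselEntire (ν + 1) 0))
  nlinarith [abs_nonneg (besselEntire (ν + 2) 0), mul_nonneg h5 ht]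

theorem sqrt_mul_besselJ {ν : ℝ} (hν : -1 < ν) {t : ℝ} (ht : 0 < t) :
    (Real.sqrt t : ℂ) * besselJ ν (2 * Real.sqrt t) =
      ((t ^ ((ν + 1) / 2) * besselEntire ν t : ℝ) : ℂ) := by
  have h := (hasSum_besselEntire hν t).mul_left (t ^ (ν / 2))
  have hs : HasSum (fun k : ℕ ↦ ((-1 : ℂ) ^ k *
      ((2 * Real.sqrt t / 2 : ℝ) : ℂ) ^ ((ν : ℂ) + 2 * (k : ℂ))) /
      (Complex.Gamma ((k : ℂ) + 1) * Complex.Gamma ((k : ℂ) + ν + 1)))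
      ((t ^ (ν / 2) * besselEntire ν t : ℝ) : ℂ) := by
    convert Complex.hasSum_ofReal.2 h using 2 with k
    have e1 : (2 * Real.sqrt t / 2 : ℝ) = t ^ (1 / 2 : ℝ) := by
      rw [Real.sqrt_eq_rpow]; ring
    have e2 : ((ν : ℂ) + 2 * (k : ℂ)) = ((ν + 2 * k : ℝ) : ℂ) := by push_cast; ring
    have e3 : ((k : ℂ) + ν + 1) = ((k + ν + 1 : ℝ) : ℂ) := by push_cast; ring
    have e4 : (t ^ (1 / 2 : ℝ)) ^ (ν + 2 * k) = t ^ (ν / 2) * t ^ k := by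
      rw [← Real.rpow_mul ht.le, ← Real.rpow_natCast t k, ← Real.rpow_add ht]
      congr 1; ring
    rw [e1, e2, e3, Complex.Gamma_nat_eq_factorial, Complex.Gamma_ofReal,
      ← Complex.ofReal_cpow (Real.rpow_nonneg ht.le _), e4, neg_pow t]
    push_cast
    ring
  rw [besselJ, hs.tsum_eq, ← Complex.ofReal_mul, ← mul_assoc, Real.sqrt_eq_rpow,
    ← Real.rpow_add ht]
  congr 4; ring

/-- The integral transform on `(0,∞)` with kernel `besselEntire ν (x * y)`. -/
noncomputable def besselTransform (ν : ℝ) (A : ℝ → ℂ) (y : ℝ) : ℂ :=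
  ∫ x in Ioi (0 : ℝ), A x * (besselEntire ν (x * y) : ℂ)

/-- Integrability on `(0,∞)` against the weight `1 + x`. -/
def WeightedIntegrable (A : ℝ → ℂ) : Prop :=
  AEStronglyMeasurable A (volume.restrict (Ioi 0)) ∧
    IntegrableOn (fun x ↦ (1 + x) * ‖A x‖) (Ioi 0)

theorem exists_abs_besselEntire_mul_le {ν : ℝ} (hν : -1 < ν) :
    ∃ C : ℝ, 0 ≤ C ∧ ∀ x y, 0 < x → 0 < y → |besselEntire ν (x * y)| ≤ C * ((1 + x) * (1 + y)) := by
  obtain ⟨C, hC, h⟩ := exists_abs_besselEntire_le hν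
  refine ⟨C, hC, fun x y hx hy ↦ (h _ (mul_pos hx hy).le).trans ?_⟩
  gcongr
  nlinarith

theorem WeightedIntegrable.conj {A : ℝ → ℂ} (hA : WeightedIntegrable A) :
    WeightedIntegrable fun x ↦ (starRingEnd ℂ) (A x) :=
  ⟨Complex.continuous_conj.comp_aestronglyMeasurable hA.1, by simpa using hA.2⟩

theorem WeightedIntegrable.integrableOn {A : ℝ → ℂ} (hA : WeightedIntegrable A) :
    IntegrableOn A (Ioi 0) := by
  refine Integrable.mono' hA.2 hA.1 (ae_restrict_of_forall_mem measurableSet_Ioi fun x hx ↦ ?_)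
  exact le_mul_of_one_le_left (norm_nonneg _) (by linarith [mem_Ioi.1 hx])

theorem exists_norm_besselTransform_le {ν : ℝ} (hν : -1 < ν) {A : ℝ → ℂ}
    (hA : WeightedIntegrable A) :
    ∃ C : ℝ, 0 ≤ C ∧ ∀ y, 0 < y → ‖besselTransform ν A y‖ ≤ C * (1 + y) := by
  obtain ⟨C, hC, h⟩ := exists_abs_besselEntire_mul_le hν
  refine ⟨C * ∫ x in Ioi (0 : ℝ), (1 + x) * ‖A x‖, mul_nonneg hC
    (setIntegral_nonneg measurableSet_Ioi fun x hx ↦ mul_nonneg (by linarith [mem_Ioi.1 hx])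
      (norm_nonneg _)), fun y hy ↦ ?_⟩
  have := norm_integral_le_of_norm_le (μ := volume.restrict (Ioi 0))
    (f := fun x ↦ A x * (besselEntire ν (x * y) : ℂ)) (hA.2.const_mul (C * (1 + y)))
    (ae_restrict_of_forall_mem measurableSet_Ioi fun x hx ↦ by
      rw [norm_mul, Complex.norm_real, Real.norm_eq_abs]
      refine (mul_le_mul_of_nonneg_left (h x y hx hy) (norm_nonneg _)).trans_eq ?_
      ring)
  refine this.trans_eq ?_
  rw [integral_const_mul]; ring

theorem aestronglyMeasurable_besselTransform {ν : ℝ} (hν : -1 < ν) {A : ℝ → ℂ}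
    (hA : AEStronglyMeasurable A (volume.restrict (Ioi 0))) :
    AEStronglyMeasurable (besselTransform ν A) (volume.restrict (Ioi 0)) := by
  refine AEStronglyMeasurable.integral_prod_right' (μ := volume.restrict (Ioi 0))
    (f := fun p : ℝ × ℝ ↦ A p.2 * (besselEntire ν (p.2 * p.1) : ℂ)) (hA.comp_snd.mul ?_)
  have := continuous_besselEntire hν
  exact Continuous.aestronglyMeasurable (by fun_prop)

theorem integral_mul_besselTransform {ν : ℝ} (hν : -1 < ν) {A B : ℝ → ℂ}
    (hA : WeightedIntegrable A) (hB : WeightedIntegrable B) :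
    ∫ y in Ioi (0 : ℝ), B y * besselTransform ν A y =
      ∫ x in Ioi (0 : ℝ), A x * besselTransform ν B x := by
  obtain ⟨C, hC, h⟩ := exists_abs_besselEntire_mul_le hν
  have hE := continuous_besselEntire hν
  have h_int : Integrable (Function.uncurry fun y x ↦ B y * (A x * (besselEntire ν (x * y) : ℂ)))
      ((volume.restrict (Ioi 0)).prod (volume.restrict (Ioi 0))) := by
    refine Integrable.mono' ((hB.2.mul_prod hA.2).const_mul C) ?_ ?_
    · exact hB.1.comp_fst.mul (hA.1.comp_snd.mul (Continuous.aestronglyMeasurable (by fun_prop)))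
    · rw [Measure.prod_restrict]
      refine ae_restrict_of_forall_mem (measurableSet_Ioi.prod measurableSet_Ioi) ?_
      rintro ⟨y, x⟩ ⟨hy, hx⟩
      simp only [Function.uncurry, norm_mul, Complex.norm_real, Real.norm_eq_abs]
      calc ‖B y‖ * (‖A x‖ * |besselEntire ν (x * y)|)
          ≤ ‖B y‖ * (‖A x‖ * (C * ((1 + x) * (1 + y)))) := by
            gcongr; exact h x y hx hy
        _ = _ := by ring
  have hswap := integral_integral_swap h_int
  simp only [besselTransform, ← integral_const_mul]
  rw [hswap]
  refine integral_congr_ae (.of_forall fun x ↦ integral_congr_ae (.of_forall fun y ↦ ?_))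
  simp only [mul_comm x y]
  ring

theorem besselTransform_conj (ν : ℝ) (A : ℝ → ℂ) (y : ℝ) :
    besselTransform ν (fun x ↦ (starRingEnd ℂ) (A x)) y =
      (starRingEnd ℂ) (besselTransform ν A y) := by
  simp [besselTransform, ← integral_conj]

theorem integrableOn_rpow_mul_exp_neg {a s : ℝ} (ha : -1 < a) (hs : 0 < s) :
    IntegrableOn (fun x : ℝ ↦ x ^ a * Real.exp (-(s * x))) (Ioi 0) := by
  simpa using integrableOn_rpow_mul_exp_neg_mul_rpow (p := 1) ha zero_lt_one hs

theorem integral_rpow_mul_exp_mul_besselEntire {ν : ℝ} (hν : -1 < ν) {s : ℝ} (hs : 0 < s)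
    {y : ℝ} (hy : 0 < y) :
    ∫ x in Ioi (0 : ℝ), x ^ ν * Real.exp (-(s * x)) * besselEntire ν (x * y) =
      (1 / s) ^ (ν + 1) * Real.exp (-(1 / s * y)) := by
  set F : ℕ → ℝ → ℝ := fun k x ↦ (-y) ^ k / (k.factorial * Real.Gamma (k + ν + 1)) *
    (x ^ (k + ν + 1 - 1) * Real.exp (-(s * x))) with hF
  have hk : ∀ k : ℕ, (0 : ℝ) < k + ν + 1 := fun k ↦ by
    have := k.cast_nonneg (α := ℝ); linarith
  have h_int : ∀ k, Integrable (F k) (volume.restrict (Ioi 0)) := fun k ↦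
    (integrableOn_rpow_mul_exp_neg (by linarith [hk k]) hs).const_mul _
  have hpow : ∀ k : ℕ, (1 / s) ^ (k + ν + 1) = (1 / s) ^ k * (1 / s) ^ (ν + 1) := fun k ↦ by
    rw [add_assoc, Real.rpow_add (by positivity), Real.rpow_natCast]
  have hval : ∀ k, ∫ x in Ioi (0 : ℝ), F k x =
      (1 / s) ^ (ν + 1) * ((-(1 / s * y)) ^ k / k.factorial) := fun k ↦ by
    have hΓ := (Gamma_nat_add_pos hν k).ne'
    rw [integral_const_mul, Real.integral_rpow_mul_exp_neg_mul_Ioi (hk k) hs, hpow,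
      neg_pow (1 / s * y), mul_pow, neg_pow y]
    field_simp
  have hnorm : ∀ k, ∫ x in Ioi (0 : ℝ), ‖F k x‖ =
      (1 / s) ^ (ν + 1) * ((1 / s * y) ^ k / k.factorial) := fun k ↦ by
    have hΓ := Gamma_nat_add_pos hν k
    have : ∀ x ∈ Ioi (0 : ℝ), ‖F k x‖ = y ^ k / (k.factorial * Real.Gamma (k + ν + 1)) *
        (x ^ (k + ν + 1 - 1) * Real.exp (-(s * x))) := fun x hx ↦ by
      have hx' : (0 : ℝ) < x := hx
      rw [hF, Real.norm_eq_abs, abs_mul, abs_div, abs_pow, abs_neg, abs_of_pos hy,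
        abs_of_pos (mul_pos (by positivity) hΓ), abs_of_pos (by positivity)]
    rw [setIntegral_congr_fun measurableSet_Ioi this, integral_const_mul,
      Real.integral_rpow_mul_exp_neg_mul_Ioi (hk k) hs, hpow, mul_pow]
    have := hΓ.ne'
    field_simp
  have hsum := hasSum_integral_of_summable_integral_norm h_int (by
    simp only [hnorm]
    exact (Real.summable_pow_div_factorial _).mul_left _)
  simp only [hval] at hsum
  have hexp := (NormedSpace.expSeries_div_hasSum_exp (-(1 / s * y))).mul_left
    ((1 / s) ^ (ν + 1))
  rw [← Real.exp_eq_exp_ℝ] at hexp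
  rw [← hsum.unique hexp]
  refine setIntegral_congr_fun measurableSet_Ioi fun x hx ↦ ?_
  have h := (hasSum_besselEntire hν (x * y)).mul_left (x ^ ν * Real.exp (-(s * x)))
  refine (h.congr_fun fun k ↦ ?_).tsum_eq.symm
  have e : (k + ν + 1 - 1 : ℝ) = ν + k := by ring
  simp only [hF]
  rw [e, Real.rpow_add hx, Real.rpow_natCast, neg_pow y, neg_pow (x * y), mul_pow]
  ring

/-- The function `x ↦ x ^ ν * exp (-s x)`. -/
noncomputable def rpowExp (ν s x : ℝ) : ℂ := ((x ^ ν * Real.exp (-(s * x)) : ℝ) : ℂ)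

theorem weightedIntegrable_rpowExp {ν : ℝ} (hν : -1 < ν) {s : ℝ} (hs : 0 < s) :
    WeightedIntegrable (rpowExp ν s) := by
  have h0 := integrableOn_rpow_mul_exp_neg hν hs
  have h1 := integrableOn_rpow_mul_exp_neg (a := ν + 1) (by linarith) hs
  refine ⟨Complex.continuous_ofReal.comp_aestronglyMeasurable h0.aestronglyMeasurable, ?_⟩
  refine (h0.add h1).congr_fun (fun x hx ↦ ?_) measurableSet_Ioi
  have hx' : (0 : ℝ) < x := hx
  simp only [rpowExp, Complex.norm_real, Pi.add_apply]
  rw [Real.norm_of_nonneg (by positivity), Real.rpow_add hx', Real.rpow_one]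
  ring

theorem besselTransform_rpowExp {ν : ℝ} (hν : -1 < ν) {s : ℝ} (hs : 0 < s) {y : ℝ} (hy : 0 < y) :
    besselTransform ν (rpowExp ν s) y =
      (((1 / s) ^ (ν + 1) * Real.exp (-(1 / s * y)) : ℝ) : ℂ) := by
  rw [← integral_rpow_mul_exp_mul_besselEntire hν hs hy, ← integral_complex_ofReal]
  simp [besselTransform, rpowExp]

theorem ae_eq_zero_of_forall_integral_exp_pow_mul_eq_zero {v : ℝ → ℂ}
    (hv : IntegrableOn v (Ioi 0))
    (h : ∀ n : ℕ, ∫ x in Ioi (0 : ℝ), ((Real.exp (-x) ^ n : ℝ) : ℂ) * v x = 0) :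
    ∀ᵐ x, x ∈ Ioi (0 : ℝ) → v x = 0 := by
  refine IsOpen.ae_eq_zero_of_integral_contDiff_smul_eq_zero isOpen_Ioi hv.locallyIntegrableOn ?_
  intro ψ hψ hψc hψs
  have hψ0 : ∀ x, x ∉ Ioi (0 : ℝ) → ψ x = 0 := fun x hx ↦
    image_eq_zero_of_notMem_tsupport fun h' ↦ hx (hψs h')
  have hφ : Continuous fun u ↦ ψ (-Real.log u) := by
    refine continuous_iff_continuousAt.2 fun u ↦ ?_
    rcases eq_or_ne u 0 with rfl | hu
    · rw [continuousAt_iff_punctured_nhds]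
      have h0 : ψ (-Real.log 0) = 0 := hψ0 _ (by simp)
      rw [h0]
      exact (hψc.is_zero_at_infty.mono_left atTop_le_cocompact).comp
        (Filter.tendsto_neg_atBot_atTop.comp Real.tendsto_log_nhdsNE_zero)
    · exact (hψ.continuous.continuousAt).comp (Real.continuousAt_log hu).neg
  have hrestrict : ∫ x, ψ x • v x = ∫ x in Ioi (0 : ℝ), (ψ x : ℂ) * v x := by
    rw [← setIntegral_eq_integral_of_forall_compl_eq_zero (s := Ioi (0 : ℝ))
      fun x hx ↦ by rw [hψ0 x hx, zero_smul]]
    simp only [Complex.real_smul]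
  rw [hrestrict]
  have hbdd : ∀ θ : ℝ → ℝ, Continuous θ → (∃ C, ∀ x ∈ Ioi (0 : ℝ), |θ x| ≤ C) →
      IntegrableOn (fun x ↦ (θ x : ℂ) * v x) (Ioi 0) := fun θ hθ ⟨C, hC⟩ ↦
    Integrable.bdd_mul hv (Complex.continuous_ofReal.comp hθ).aestronglyMeasurable
      (ae_restrict_of_forall_mem measurableSet_Ioi fun x hx ↦ by simpa using hC x hx)
  have hexp : ∀ x ∈ Ioi (0 : ℝ), Real.exp (-x) ∈ Icc (0 : ℝ) 1 := fun x hx ↦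
    ⟨(Real.exp_pos _).le, Real.exp_le_one_iff.2 (by linarith [mem_Ioi.1 hx])⟩
  have hpow : ∀ n : ℕ, IntegrableOn (fun x ↦ ((Real.exp (-x) ^ n : ℝ) : ℂ) * v x) (Ioi 0) :=
    fun n ↦ hbdd (fun x ↦ Real.exp (-x) ^ n) (by fun_prop) ⟨1, fun x hx ↦ by
      rw [abs_of_nonneg (by positivity)]
      exact pow_le_one₀ (hexp x hx).1 (hexp x hx).2⟩
  have hpoly : ∀ p : Polynomial ℝ,
      IntegrableOn (fun x ↦ ((p.eval (Real.exp (-x)) : ℝ) : ℂ) * v x) (Ioi 0) ∧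
      ∫ x in Ioi (0 : ℝ), ((p.eval (Real.exp (-x)) : ℝ) : ℂ) * v x = 0 := by
    intro p
    have e : (fun x ↦ ((p.eval (Real.exp (-x)) : ℝ) : ℂ) * v x) = fun x ↦
        ∑ i ∈ Finset.range (p.natDegree + 1),
          (p.coeff i : ℂ) * (((Real.exp (-x) ^ i : ℝ) : ℂ) * v x) := by
      ext x
      rw [Polynomial.eval_eq_sum_range, Complex.ofReal_sum, Finset.sum_mul]
      refine Finset.sum_congr rfl fun i _ ↦ ?_
      rw [Complex.ofReal_mul, mul_assoc]
    rw [e]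
    refine ⟨integrable_finsetSum _ fun i _ ↦ (hpow i).const_mul _, ?_⟩
    rw [integral_finsetSum _ fun i _ ↦ (hpow i).const_mul _]
    simp only [integral_const_mul, h, mul_zero, Finset.sum_const_zero]
  have hψi : IntegrableOn (fun x ↦ (ψ x : ℂ) * v x) (Ioi 0) := by
    obtain ⟨C, hC⟩ := hψc.exists_bound_of_continuous hψ.continuous
    exact hbdd ψ hψ.continuous ⟨C, fun x _ ↦ hC x⟩
  set M := ∫ x in Ioi (0 : ℝ), ‖v x‖ with hM
  have hM0 : 0 ≤ M := integral_nonneg fun _ ↦ norm_nonneg _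
  refine norm_le_zero_iff.1 (le_of_forall_pos_le_add fun ε hε ↦ ?_)
  obtain ⟨p, hp⟩ := exists_polynomial_near_of_continuousOn 0 1 _ hφ.continuousOn
    (ε / (M + 1)) (by positivity)
  have hsub : ∫ x in Ioi (0 : ℝ), (ψ x : ℂ) * v x = ∫ x in Ioi (0 : ℝ),
      ((ψ x : ℂ) * v x - ((p.eval (Real.exp (-x)) : ℝ) : ℂ) * v x) := by
    rw [integral_sub hψi (hpoly p).1, (hpoly p).2, sub_zero]
  rw [hsub, zero_add]
  refine (norm_integral_le_of_norm_le (hv.norm.const_mul (ε / (M + 1)))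
    (ae_restrict_of_forall_mem measurableSet_Ioi fun x hx ↦ ?_)).trans ?_
  · rw [← sub_mul, norm_mul, ← Complex.ofReal_sub, Complex.norm_real, Real.norm_eq_abs, abs_sub_comm]
    have := hp _ (hexp x hx)
    rw [Real.log_exp, neg_neg] at this
    gcongr
  · rw [integral_const_mul, ← hM, div_mul_eq_mul_div, div_le_iff₀ (by positivity)]
    nlinarith

theorem besselTransform_besselTransform {ν : ℝ} (hν : -1 < ν) {g : ℝ → ℂ}
    (hg : WeightedIntegrable fun x ↦ ((x ^ ν : ℝ) : ℂ) * g x)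
    (hG : WeightedIntegrable fun y ↦ ((y ^ ν : ℝ) : ℂ) *
      besselTransform ν (fun x ↦ ((x ^ ν : ℝ) : ℂ) * g x) y) :
    ∀ᵐ x, x ∈ Ioi (0 : ℝ) → besselTransform ν (fun y ↦ ((y ^ ν : ℝ) : ℂ) *
      besselTransform ν (fun x ↦ ((x ^ ν : ℝ) : ℂ) * g x) y) x = g x := by
  set A : ℝ → ℂ := fun x ↦ ((x ^ ν : ℝ) : ℂ) * g x with hA
  set B : ℝ → ℂ := fun y ↦ ((y ^ ν : ℝ) : ℂ) * besselTransform ν A y with hB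
  obtain ⟨C, hC, hCB⟩ := exists_norm_besselTransform_le hν hG
  have hKB := aestronglyMeasurable_besselTransform hν hG.1
  have hint1 : ∀ s : ℝ, 0 < s →
      IntegrableOn (fun x ↦ rpowExp ν s x * besselTransform ν B x) (Ioi 0) := fun s hs ↦ by
    have hw := weightedIntegrable_rpowExp hν hs
    refine Integrable.mono' (hw.2.const_mul C) (hw.1.mul hKB)
      (ae_restrict_of_forall_mem measurableSet_Ioi fun x hx ↦ ?_)
    rw [norm_mul]
    refine (mul_le_mul_of_nonneg_left (hCB x hx) (norm_nonneg _)).trans_eq ?_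
    ring
  have hint2 : ∀ s : ℝ, 0 < s →
      IntegrableOn (fun x ↦ (Real.exp (-(s * x)) : ℂ) * A x) (Ioi 0) := fun s hs ↦ by
    refine Integrable.bdd_mul (c := 1) hg.integrableOn
      (Continuous.aestronglyMeasurable (by fun_prop))
      (ae_restrict_of_forall_mem measurableSet_Ioi fun x hx ↦ ?_)
    have hx' : (0 : ℝ) < x := hx
    rw [Complex.norm_real, Real.norm_of_nonneg (Real.exp_pos _).le]
    exact Real.exp_le_one_iff.2 (by nlinarith)
  have hlap : ∀ s : ℝ, 0 < s → ∫ x in Ioi (0 : ℝ), rpowExp ν s x * besselTransform ν B x =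
      ∫ x in Ioi (0 : ℝ), (Real.exp (-(s * x)) : ℂ) * A x := fun s hs ↦ by
    have hs' : 0 < 1 / s := by positivity
    calc ∫ x in Ioi (0 : ℝ), rpowExp ν s x * besselTransform ν B x
        = ∫ y in Ioi (0 : ℝ), B y * besselTransform ν (rpowExp ν s) y :=
          integral_mul_besselTransform hν hG (weightedIntegrable_rpowExp hν hs)
      _ = ∫ y in Ioi (0 : ℝ), (((1 / s) ^ (ν + 1) : ℝ) : ℂ) *
            (rpowExp ν (1 / s) y * besselTransform ν A y) := by
          refine setIntegral_congr_fun measurableSet_Ioi fun y hy ↦ ?_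
          simp only [besselTransform_rpowExp hν hs hy, hB, rpowExp]
          push_cast; ring
      _ = (((1 / s) ^ (ν + 1) : ℝ) : ℂ) *
            ∫ x in Ioi (0 : ℝ), A x * besselTransform ν (rpowExp ν (1 / s)) x := by
          rw [integral_const_mul, integral_mul_besselTransform hν hg
            (weightedIntegrable_rpowExp hν hs')]
      _ = _ := by
          rw [← integral_const_mul]
          refine setIntegral_congr_fun measurableSet_Ioi fun x hx ↦ ?_
          have e : (((1 / s) ^ (ν + 1) : ℝ) : ℂ) * ((s ^ (ν + 1) : ℝ) : ℂ) = 1 := by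
            rw [← Complex.ofReal_mul, ← Real.mul_rpow hs'.le hs.le, one_div_mul_cancel hs.ne',
              Real.one_rpow, Complex.ofReal_one]
          simp only [besselTransform_rpowExp hν hs' hx, one_div_one_div]
          rw [Complex.ofReal_mul]
          linear_combination A x * (Real.exp (-(s * x)) : ℂ) * e
  have hv0 := (hint1 1 one_pos).sub (hint2 1 one_pos)
  have hae := ae_eq_zero_of_forall_integral_exp_pow_mul_eq_zero hv0 fun n ↦ by
    have hn : (0 : ℝ) < n + 1 := by positivity
    rw [← sub_eq_zero.2 (hlap (n + 1) hn), ← integral_sub (hint1 _ hn) (hint2 _ hn)]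
    refine setIntegral_congr_fun measurableSet_Ioi fun x hx ↦ ?_
    have e : Real.exp (-((n + 1) * x)) = Real.exp (-x) ^ n * Real.exp (-(1 * x)) := by
      rw [← Real.exp_nat_mul, ← Real.exp_add]; congr 1; ring
    simp only [rpowExp, Pi.sub_apply]
    rw [e]
    push_cast
    ring
  filter_upwards [hae] with x hx hx0
  have h := hx hx0
  have hx' : (0 : ℝ) < x := hx0
  have hne : (((x ^ ν * Real.exp (-(1 * x)) : ℝ)) : ℂ) ≠ 0 :=
    Complex.ofReal_ne_zero.2 (by positivity)
  refine mul_left_cancel₀ hne (sub_eq_zero.1 (Eq.trans ?_ h))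
  simp only [rpowExp, Pi.sub_apply, hA]
  push_cast
  ring

/-- Boundedness near `0` together with rapid decay at `+∞`. -/
def RapidDecay (a : ℝ → ℂ) : Prop :=
  AEStronglyMeasurable a (volume.restrict (Ioi 0)) ∧ (∃ C, ∀ x, 0 < x → x ≤ 1 → ‖a x‖ ≤ C) ∧
    ∀ n : ℕ, ∃ C, ∀ x, 1 ≤ x → x ^ n * ‖a x‖ ≤ C

theorem RapidDecay.weightedIntegrable {ν : ℝ} (hν : -1 < ν) {a : ℝ → ℂ} (ha : RapidDecay a) :
    WeightedIntegrable fun x ↦ ((x ^ ν : ℝ) : ℂ) * a x := by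
  obtain ⟨ham, ⟨C₀, h0⟩, h⟩ := ha
  have hm : AEStronglyMeasurable (fun x : ℝ ↦ ((x ^ ν : ℝ) : ℂ) * a x)
      (volume.restrict (Ioi 0)) :=
    (Complex.measurable_ofReal.comp (measurable_id.pow_const ν)).aestronglyMeasurable.mul ham
  refine ⟨hm, ?_⟩
  have hm' : AEStronglyMeasurable (fun x : ℝ ↦ (1 + x) * ‖((x ^ ν : ℝ) : ℂ) * a x‖)
      (volume.restrict (Ioi 0)) :=
    Continuous.aestronglyMeasurable (by fun_prop) |>.mul hm.norm
  have hnorm : ∀ x : ℝ, 0 < x → ‖(1 + x) * ‖((x ^ ν : ℝ) : ℂ) * a x‖‖ =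
      (1 + x) * (x ^ ν * ‖a x‖) := fun x hx ↦ by
    rw [Real.norm_of_nonneg (by positivity), norm_mul, Complex.norm_real,
      Real.norm_of_nonneg (by positivity)]
  rw [← Ioc_union_Ioi_eq_Ioi zero_le_one]
  refine IntegrableOn.union ?_ ?_
  · have hi := (intervalIntegral.intervalIntegrable_rpow' (a := 0) (b := 1) hν).1
    refine Integrable.mono' (hi.const_mul (2 * C₀)) (hm'.mono_set Ioc_subset_Ioi_self)
      (ae_restrict_of_forall_mem measurableSet_Ioc fun x hx ↦ ?_)
    have hx0 : 0 < x := hx.1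
    rw [hnorm x hx0]
    calc (1 + x) * (x ^ ν * ‖a x‖) ≤ 2 * (x ^ ν * C₀) := by
          gcongr
          · linarith [hx.2]
          · exact h0 x hx.1 hx.2
      _ = _ := by ring
  · obtain ⟨C, hC⟩ := h (⌈ν⌉₊ + 3)
    have hn : ν + 1 - (⌈ν⌉₊ + 3 : ℕ) < -1 := by
      have := Nat.le_ceil ν
      push_cast; linarith
    refine Integrable.mono' ((integrableOn_Ioi_rpow_of_lt hn one_pos).const_mul (2 * C))
      (hm'.mono_set (Ioi_subset_Ioi zero_le_one))
      (ae_restrict_of_forall_mem measurableSet_Ioi fun x hx ↦ ?_)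
    have hx1 : 1 < x := hx
    have hx0 : 0 < x := by linarith
    rw [hnorm x hx0, Real.rpow_sub hx0, Real.rpow_natCast, Real.rpow_add hx0, Real.rpow_one]
    have := hC x hx1.le
    rw [← le_div_iff₀' (by positivity)] at this
    calc (1 + x) * (x ^ ν * ‖a x‖) ≤ (2 * x) * (x ^ ν * (C / x ^ (⌈ν⌉₊ + 3))) := by
          gcongr
          linarith
      _ = _ := by ring

theorem WeightedIntegrable.integrableOn_mul_besselEntire {ν : ℝ} (hν : -1 < ν) {A : ℝ → ℂ}
    (hA : WeightedIntegrable A) {y : ℝ} (hy : 0 < y) :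
    IntegrableOn (fun x ↦ A x * (besselEntire ν (x * y) : ℂ)) (Ioi 0) := by
  obtain ⟨C, hC, h⟩ := exists_abs_besselEntire_mul_le hν
  have hE := continuous_besselEntire hν
  refine Integrable.mono' (hA.2.const_mul (C * (1 + y)))
    (hA.1.mul (Continuous.aestronglyMeasurable (by fun_prop)))
    (ae_restrict_of_forall_mem measurableSet_Ioi fun x hx ↦ ?_)
  rw [norm_mul, Complex.norm_real, Real.norm_eq_abs]
  refine (mul_le_mul_of_nonneg_left (h x y hx hy) (norm_nonneg _)).trans_eq ?_
  ring

/-- Smoothness on `ℝ` together with rapid decay at `+∞` of all derivatives. -/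
def SchwartzAtTop (g : ℝ → ℂ) : Prop :=
  ContDiff ℝ (⊤ : ℕ∞) g ∧ RapidlyDecreasing g

namespace SchwartzAtTop

variable {g h : ℝ → ℂ}

theorem contDiff_nat (hg : SchwartzAtTop g) (n : ℕ) : ContDiff ℝ n g :=
  hg.1.of_le (by exact_mod_cast le_top)

theorem hasDerivAt (hg : SchwartzAtTop g) (x : ℝ) : HasDerivAt g (deriv g x) x :=
  (((hg.contDiff_nat 1).differentiable (by simp)) x).hasDerivAt

theorem deriv (hg : SchwartzAtTop g) : SchwartzAtTop (deriv g) := by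
  refine ⟨(contDiff_infty_iff_deriv.1 hg.1).2, fun m n ↦ ?_⟩
  obtain ⟨C, hC⟩ := hg.2 m (n + 1)
  exact ⟨C, fun x hx ↦ by simpa only [iteratedDeriv_succ'] using hC x hx⟩

theorem add (hg : SchwartzAtTop g) (hh : SchwartzAtTop h) :
    SchwartzAtTop fun x ↦ g x + h x := by
  refine ⟨hg.1.add hh.1, fun m n ↦ ?_⟩
  obtain ⟨C, hC⟩ := hg.2 m n
  obtain ⟨C', hC'⟩ := hh.2 m n
  refine ⟨C + C', fun x hx ↦ ?_⟩
  rw [iteratedDeriv_fun_add (hg.contDiff_nat n).contDiffAt (hh.contDiff_nat n).contDiffAt]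
  refine le_trans ?_ (add_le_add (hC x hx) (hC' x hx))
  rw [← mul_add]
  gcongr
  exact norm_add_le _ _

theorem const_mul (hg : SchwartzAtTop g) (c : ℂ) : SchwartzAtTop fun x ↦ c * g x := by
  refine ⟨contDiff_const.mul hg.1, fun m n ↦ ?_⟩
  obtain ⟨C, hC⟩ := hg.2 m n
  refine ⟨‖c‖ * C, fun x hx ↦ ?_⟩
  rw [iteratedDeriv_const_mul_field, norm_mul, mul_left_comm]
  exact mul_le_mul_of_nonneg_left (hC x hx) (norm_nonneg _)

theorem id_mul (hg : SchwartzAtTop g) : SchwartzAtTop fun x ↦ (x : ℂ) * g x := by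
  refine ⟨Complex.ofRealCLM.contDiff.mul hg.1, fun m n ↦ ?_⟩
  induction n generalizing g with
  | zero =>
    obtain ⟨C, hC⟩ := hg.2 (m + 1) 0
    refine ⟨C, fun x hx ↦ ?_⟩
    have := hC x hx
    simp only [iteratedDeriv_zero] at this ⊢
    rwa [norm_mul, Complex.norm_real, Real.norm_of_nonneg (by linarith), ← mul_assoc, ← pow_succ]
  | succ n ih =>
    obtain ⟨C, hC⟩ := hg.2 m n
    obtain ⟨C', hC'⟩ := ih hg.deriv
    refine ⟨C + C', fun x hx ↦ ?_⟩
    have e : _root_.deriv (fun x : ℝ ↦ (x : ℂ) * g x) =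
        fun x ↦ g x + (x : ℂ) * _root_.deriv g x := by
      ext x
      simpa using ((hasDerivAt_id x).ofReal_comp.fun_mul (hg.hasDerivAt x)).deriv
    have hc : ContDiff ℝ n fun x : ℝ ↦ (x : ℂ) * _root_.deriv g x :=
      Complex.ofRealCLM.contDiff.mul (hg.deriv.contDiff_nat n)
    rw [iteratedDeriv_succ', e, iteratedDeriv_fun_add (hg.contDiff_nat n).contDiffAt hc.contDiffAt]
    refine le_trans ?_ (add_le_add (hC x hx) (hC' x hx))
    rw [← mul_add]
    gcongr
    exact norm_add_le _ _

theorem rapidDecay (hg : SchwartzAtTop g) : RapidDecay g := by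
  refine ⟨hg.1.continuous.aestronglyMeasurable, ?_, fun n ↦ ?_⟩
  · obtain ⟨C, hC⟩ := isCompact_Icc.exists_bound_of_continuousOn (s := Icc (0 : ℝ) 1)
      hg.1.continuous.continuousOn
    exact ⟨C, fun x h0 h1 ↦ hC x ⟨h0.le, h1⟩⟩
  · simpa only [iteratedDeriv_zero] using hg.2 n 0

end SchwartzAtTop

/-- The differential operator `x d²/dx² + (ν + 1) d/dx`. -/
noncomputable def besselOperator (ν : ℝ) (g : ℝ → ℂ) (x : ℝ) : ℂ :=
  (x : ℂ) * deriv (deriv g) x + ((ν + 1 : ℝ) : ℂ) * deriv g x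

theorem SchwartzAtTop.besselOperator {g : ℝ → ℂ} (hg : SchwartzAtTop g) (ν : ℝ) :
    SchwartzAtTop (besselOperator ν g) :=
  hg.deriv.deriv.id_mul.add (hg.deriv.const_mul _)

theorem mul_besselTransform_eq_neg {ν : ℝ} (hν : -1 < ν) {g : ℝ → ℂ} (hg : SchwartzAtTop g)
    {y : ℝ} (hy : 0 < y) :
    (y : ℂ) * besselTransform ν (fun x ↦ ((x ^ ν : ℝ) : ℂ) * g x) y =
      -besselTransform ν (fun x ↦ ((x ^ ν : ℝ) : ℂ) * besselOperator ν g x) y := by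
  have hν1 : -1 < ν + 1 := by linarith
  have hE : ∀ μ : ℝ, -1 < μ → ∀ x : ℝ, HasDerivAt (fun x ↦ (besselEntire μ (x * y) : ℂ))
      (-(besselEntire (μ + 1) (x * y) : ℂ) * y) x := fun μ hμ x ↦ by
    have := ((hasDerivAt_besselEntire hμ (x * y)).comp x
      ((hasDerivAt_id x).mul_const y)).ofReal_comp
    simpa using this
  set F : ℝ → ℂ := fun x ↦ ((x ^ (ν + 1) : ℝ) : ℂ) *
    (-(y : ℂ) * (g x * (besselEntire (ν + 1) (x * y) : ℂ)) -
      deriv g x * (besselEntire ν (x * y) : ℂ)) with hF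
  have hi1 := ((hg.rapidDecay.weightedIntegrable hν).integrableOn_mul_besselEntire hν hy)
  have hi2 := (((hg.besselOperator ν).rapidDecay.weightedIntegrable
    hν).integrableOn_mul_besselEntire hν hy)
  have hF' : ∀ x ∈ Ioi (0 : ℝ), HasDerivAt F
      (-(y : ℂ) * (((x ^ ν : ℝ) : ℂ) * g x * (besselEntire ν (x * y) : ℂ)) -
        ((x ^ ν : ℝ) : ℂ) * besselOperator ν g x * (besselEntire ν (x * y) : ℂ)) x := by
    intro x hx
    have hx0 : 0 < x := hx
    have hp := (Real.hasDerivAt_rpow_const (x := x) (p := ν + 1) (Or.inl hx0.ne')).ofReal_comp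
    refine (hp.fun_mul ((((hg.hasDerivAt x).fun_mul (hE (ν + 1) hν1 x)).const_mul (-(y : ℂ))).fun_sub
      ((hg.deriv.hasDerivAt x).fun_mul (hE ν hν x)))).congr_deriv ?_
    have hr := besselEntire_recurrence hν (x * y)
    rw [show ν + 1 + 1 = ν + 2 by ring, add_sub_cancel_right, Real.rpow_add hx0, Real.rpow_one,
      besselOperator]
    have hr' : (besselEntire ν (x * y) : ℂ) = (ν + 1) * (besselEntire (ν + 1) (x * y) : ℂ) -
        x * y * (besselEntire (ν + 2) (x * y) : ℂ) := by
      rw [hr]; push_cast; ring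
    push_cast
    linear_combination ((x ^ ν : ℝ) : ℂ) * y * g x * hr'
  have hFi : IntegrableOn F (Ioi 0) := by
    have h1 := ((hg.rapidDecay.weightedIntegrable hν1).integrableOn_mul_besselEntire hν1 hy)
    have h2 := ((hg.deriv.rapidDecay.weightedIntegrable hν1).integrableOn_mul_besselEntire hν hy)
    refine IntegrableOn.congr_fun ((h1.const_mul (-(y : ℂ))).sub h2) (fun x _ ↦ ?_)
      measurableSet_Ioi
    simp only [hF, Pi.sub_apply]
    ring
  have hF'i := (hi1.const_mul (-(y : ℂ))).sub hi2
  have hc : ContinuousWithinAt F (Ici 0) 0 := by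
    have hc0 := continuous_besselEntire hν
    have hc1 := continuous_besselEntire hν1
    have hg0 := hg.1.continuous
    have hg1 := hg.deriv.1.continuous
    have hp : Continuous fun x : ℝ ↦ x ^ (ν + 1) :=
      Real.continuous_rpow_const (by linarith)
    exact Continuous.continuousWithinAt (by fun_prop)
  have key := integral_Ioi_of_hasDerivAt_of_tendsto hc hF' hF'i
    (tendsto_zero_of_hasDerivAt_of_integrableOn_Ioi hF' hF'i hFi)
  have hF0 : F 0 = 0 := by
    simp [hF, Real.zero_rpow (by linarith : ν + 1 ≠ 0)]
  rw [hF0, sub_zero, integral_sub (hi1.const_mul _) hi2, integral_const_mul] at key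
  simp only [besselTransform]
  linear_combination -key

theorem SchwartzAtTop.rapidDecay_besselTransform {ν : ℝ} (hν : -1 < ν) {g : ℝ → ℂ}
    (hg : SchwartzAtTop g) :
    RapidDecay (besselTransform ν fun x ↦ ((x ^ ν : ℝ) : ℂ) * g x) := by
  have hpoly : ∀ n : ℕ, ∀ g : ℝ → ℂ, SchwartzAtTop g → ∃ C : ℝ, 0 ≤ C ∧ ∀ y, 0 < y →
      y ^ n * ‖besselTransform ν (fun x ↦ ((x ^ ν : ℝ) : ℂ) * g x) y‖ ≤ C * (1 + y) := by
    intro n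
    induction n with
    | zero =>
      intro g hg
      simpa using exists_norm_besselTransform_le hν (hg.rapidDecay.weightedIntegrable hν)
    | succ n ih =>
      intro g hg
      obtain ⟨C, hC, h⟩ := ih _ (hg.besselOperator ν)
      refine ⟨C, hC, fun y hy ↦ ?_⟩
      have e := congrArg norm (mul_besselTransform_eq_neg hν hg hy)
      rw [norm_neg, norm_mul, Complex.norm_real, Real.norm_of_nonneg hy.le] at e
      rw [pow_succ, mul_assoc, e]
      exact h y hy
  refine ⟨aestronglyMeasurable_besselTransform hν (hg.rapidDecay.weightedIntegrable hν).1, ?_,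
    fun n ↦ ?_⟩
  · obtain ⟨C, hC, h⟩ := hpoly 0 g hg
    refine ⟨C * 2, fun x h0 h1 ↦ ?_⟩
    have := h x h0
    rw [pow_zero, one_mul] at this
    exact this.trans (by gcongr; linarith)
  · obtain ⟨C, hC, h⟩ := hpoly (n + 1) g hg
    refine ⟨2 * C, fun x hx ↦ ?_⟩
    have hx0 : 0 < x := by linarith
    refine le_of_mul_le_mul_left ?_ hx0
    rw [← mul_assoc, ← pow_succ']
    refine (h x hx0).trans ?_
    nlinarith

theorem ofReal_rpow_half_mul_self (ν : ℝ) {x : ℝ} (hx : 0 < x) :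
    ((x ^ ((ν + 1) / 2) : ℝ) : ℂ) * ((x ^ ((ν + 1) / 2) : ℝ) : ℂ) = ((x ^ ν : ℝ) : ℂ) * x := by
  rw [← Complex.ofReal_mul, ← Complex.ofReal_mul, ← Real.rpow_add hx,
    ← Real.rpow_add_one hx.ne']
  congr 2; ring

theorem hankel_eq_rpow_mul_besselTransform {ν : ℝ} (hν : -1 < ν) {f g : ℝ → ℂ}
    (hfg : ∀ x, 0 ≤ x → f x = (x : ℂ) ^ (((ν : ℂ) + 1) / 2) * g x) {y : ℝ} (hy : 0 < y) :
    hankel (ν : ℂ) f y = ((y ^ ((ν + 1) / 2) : ℝ) : ℂ) *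
      besselTransform ν (fun x ↦ ((x ^ ν : ℝ) : ℂ) * g x) y := by
  rw [hankel, besselTransform, ← integral_const_mul]
  refine setIntegral_congr_fun measurableSet_Ioi fun x hx ↦ ?_
  have hx0 : 0 < x := hx
  have e1 : ((ν : ℂ) + 1) / 2 = (((ν + 1) / 2 : ℝ) : ℂ) := by push_cast; ring
  have hxc : (x : ℂ) ≠ 0 := Complex.ofReal_ne_zero.2 hx0.ne'
  rw [hfg x hx0.le, e1, ← Complex.ofReal_cpow hx0.le, mul_assoc,
    sqrt_mul_besselJ hν (mul_pos hx0 hy), Real.mul_rpow hx0.le hy.le, div_eq_iff hxc]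
  push_cast
  linear_combination g x * ((y ^ ((ν + 1) / 2) : ℝ) : ℂ) * (besselEntire ν (x * y) : ℂ) *
    ofReal_rpow_half_mul_self ν hx0

theorem rpow_half_mul_conj_div (ν : ℝ) {x : ℝ} (hx : 0 < x) (a b : ℂ) :
    ((x ^ ((ν + 1) / 2) : ℝ) : ℂ) * a *
      (starRingEnd ℂ) (((x ^ ((ν + 1) / 2) : ℝ) : ℂ) * b) / (x : ℂ) =
      (starRingEnd ℂ) (((x ^ ν : ℝ) : ℂ) * b) * a := by
  rw [div_eq_iff (Complex.ofReal_ne_zero.2 hx.ne'), map_mul, map_mul, Complex.conj_ofReal,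
    Complex.conj_ofReal]
  linear_combination a * (starRingEnd ℂ) b * ofReal_rpow_half_mul_self ν hx

/-- L² isometry: for real `ν > -1` and `f₁, f₂ ∈ S_ν([0,∞))`,
`⟨H_ν(f₁), H_ν(f₂)⟩ = ⟨f₁, f₂⟩` where `⟨f,g⟩ = ∫₀^∞ f(x) conj(g(x)) dx/x`. -/
theorem hankel_isometry (ν : ℝ) (hν : -1 < ν) (f₁ f₂ : ℝ → ℂ)
    (hf₁ : MemSnu (ν : ℂ) f₁) (hf₂ : MemSnu (ν : ℂ) f₂) :
    (∫ x in Ioi (0 : ℝ),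
        hankel (ν : ℂ) f₁ x * (starRingEnd ℂ) (hankel (ν : ℂ) f₂ x) / (x : ℂ)) =
      ∫ x in Ioi (0 : ℝ), f₁ x * (starRingEnd ℂ) (f₂ x) / (x : ℂ) := by
  have hrepr : ∀ f, MemSnu (ν : ℂ) f → ∃ g, SchwartzAtTop g ∧
      ∀ x : ℝ, 0 ≤ x → f x = (x : ℂ) ^ (((ν : ℂ) + 1) / 2) * g x := by
    rintro f ⟨k, ⟨g, hg, hkg, hgd⟩, hfk⟩
    exact ⟨g, ⟨hg, hgd⟩, fun x hx ↦ by rw [hfk x hx, hkg x hx]⟩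
  obtain ⟨g₁, hg₁, h₁⟩ := hrepr f₁ hf₁
  obtain ⟨g₂, hg₂, h₂⟩ := hrepr f₂ hf₂
  have hA₁ := hg₁.rapidDecay.weightedIntegrable hν
  have hA₂ := hg₂.rapidDecay.weightedIntegrable hν
  have hB₂ := (hg₂.rapidDecay_besselTransform hν).weightedIntegrable hν
  set A₁ : ℝ → ℂ := fun x ↦ ((x ^ ν : ℝ) : ℂ) * g₁ x with hA₁_def
  set A₂ : ℝ → ℂ := fun x ↦ ((x ^ ν : ℝ) : ℂ) * g₂ x with hA₂_def
  set B₂ : ℝ → ℂ := fun y ↦ ((y ^ ν : ℝ) : ℂ) * besselTransform ν A₂ y with hB₂_def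
  have hinv := besselTransform_besselTransform hν hA₂ hB₂
  have hcast : ∀ x : ℝ, 0 < x → (x : ℂ) ^ (((ν : ℂ) + 1) / 2) = ((x ^ ((ν + 1) / 2) : ℝ) : ℂ) :=
    fun x hx ↦ by
      rw [Complex.ofReal_cpow hx.le]; push_cast; rfl
  calc ∫ x in Ioi (0 : ℝ), hankel (ν : ℂ) f₁ x * (starRingEnd ℂ) (hankel (ν : ℂ) f₂ x) / (x : ℂ)
      = ∫ y in Ioi (0 : ℝ), (starRingEnd ℂ) (B₂ y) * besselTransform ν A₁ y := by
        refine setIntegral_congr_fun measurableSet_Ioi fun y hy ↦ ?_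
        simp only [hankel_eq_rpow_mul_besselTransform hν h₁ hy,
          hankel_eq_rpow_mul_besselTransform hν h₂ hy]
        exact rpow_half_mul_conj_div ν hy _ _
    _ = ∫ x in Ioi (0 : ℝ), A₁ x *
          besselTransform ν (fun y ↦ (starRingEnd ℂ) (B₂ y)) x :=
        integral_mul_besselTransform hν hA₁ hB₂.conj
    _ = ∫ x in Ioi (0 : ℝ), f₁ x * (starRingEnd ℂ) (f₂ x) / (x : ℂ) := by
        refine setIntegral_congr_ae measurableSet_Ioi ?_
        filter_upwards [hinv] with x hx hx0
        rw [besselTransform_conj, hx hx0, h₁ x (le_of_lt hx0), h₂ x (le_of_lt hx0), hcast x hx0,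
          rpow_half_mul_conj_div ν hx0, map_mul, Complex.conj_ofReal]
        simp only [hA₁_def]
        ring
end

section
/- Let φ : ℝ → ℂ be smooth and let γ(x) = φ(1/x) for x ≠ 0. Then φ and all its derivatives have asymptotic expansions at infinity if and only if γ extends to a smooth function on ℝ (i.e. γ is smooth at x = 0). -/
open MeasureTheory Set

/-- `ψ` has the asymptotic expansion `ψ(x) ≈ Σ_{m=0}^∞ a_m x^{-m}` at infinity:
for every `N`, `ψ(x) - Σ_{m=0}^N a_m x^{-m} = O(|x|^{-N-1})` as `|x| → ∞`. -/
def HasAsymptoticExpansion (ψ : ℝ → ℂ) (a : ℕ → ℂ) : Prop :=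
  ∀ N : ℕ, ∃ C R : ℝ, ∀ x : ℝ, R ≤ |x| →
    ‖ψ x - ∑ m ∈ Finset.range (N + 1), a m / (x : ℂ) ^ m‖ * |x| ^ (N + 1) ≤ C

open Filter Topology

namespace HasAsymptoticExpansion

variable {ψ χ : ℝ → ℂ} {a b : ℕ → ℂ}

theorem add (hψ : HasAsymptoticExpansion ψ a) (hχ : HasAsymptoticExpansion χ b) :
    HasAsymptoticExpansion (fun x => ψ x + χ x) (fun m => a m + b m) := by
  intro N
  obtain ⟨C, R, h⟩ := hψ N
  obtain ⟨C', R', h'⟩ := hχ N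
  refine ⟨C + C', max R R', fun x hx => ?_⟩
  have h₁ := h x ((le_max_left _ _).trans hx)
  have h₂ := h' x ((le_max_right _ _).trans hx)
  refine le_trans ?_ (add_le_add h₁ h₂)
  rw [← add_mul]
  gcongr
  refine le_trans (le_of_eq ?_) (norm_add_le _ _)
  simp only [add_div, Finset.sum_add_distrib]
  congr 1
  ring

theorem const_mul (c : ℂ) (hψ : HasAsymptoticExpansion ψ a) :
    HasAsymptoticExpansion (fun x => c * ψ x) (fun m => c * a m) := by
  intro N
  obtain ⟨C, R, h⟩ := hψ N
  refine ⟨‖c‖ * C, R, fun x hx => ?_⟩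
  simp only [mul_div_assoc, ← Finset.mul_sum, ← mul_sub, norm_mul]
  rw [mul_assoc]
  exact mul_le_mul_of_nonneg_left (h x hx) (norm_nonneg c)

/-- An expansion without constant term can be multiplied by `x`. -/
theorem ofReal_mul (hψ : HasAsymptoticExpansion ψ a) (h0 : a 0 = 0) :
    HasAsymptoticExpansion (fun x => (x : ℂ) * ψ x) (fun m => a (m + 1)) := by
  intro N
  obtain ⟨C, R, h⟩ := hψ (N + 1)
  refine ⟨C, max R 1, fun x hx => ?_⟩
  have hx1 : 1 ≤ |x| := (le_max_right _ _).trans hx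
  have hx0 : (x : ℂ) ≠ 0 := by
    rw [Complex.ofReal_ne_zero]
    rintro rfl
    norm_num at hx1
  refine le_trans (le_of_eq ?_) (h x ((le_max_left _ _).trans hx))
  have key : (x : ℂ) * ψ x - ∑ m ∈ Finset.range (N + 1), a (m + 1) / (x : ℂ) ^ m
      = x * (ψ x - ∑ m ∈ Finset.range (N + 1 + 1), a m / (x : ℂ) ^ m) := by
    rw [Finset.sum_range_succ' _ (N + 1), h0, mul_sub, zero_div, add_zero, Finset.mul_sum]
    congr 1
    refine Finset.sum_congr rfl fun m _ => ?_
    field_simp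
    ring
  rw [key, norm_mul, Complex.norm_real, Real.norm_eq_abs]
  ring

theorem tendsto_cobounded (hψ : HasAsymptoticExpansion ψ a) :
    Tendsto ψ (Bornology.cobounded ℝ) (𝓝 (a 0)) := by
  obtain ⟨C, R, h⟩ := hψ 0
  have habs : Tendsto (fun x : ℝ => |x|) (Bornology.cobounded ℝ) atTop :=
    tendsto_norm_cobounded_atTop
  rw [tendsto_iff_norm_sub_tendsto_zero]
  refine squeeze_zero' (.of_forall fun _ => norm_nonneg _) ?_ (habs.const_div_atTop C)
  filter_upwards [habs.eventually_ge_atTop R, habs.eventually_gt_atTop 0] with x hx hx0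
  rw [le_div_iff₀ hx0]
  simpa using h x hx

/-- The expansion of the derivative of a function that itself has an expansion starts at
order two. -/
theorem deriv_coeff_eq_zero (hd : Differentiable ℝ ψ) (hψ : HasAsymptoticExpansion ψ a)
    (hψ' : HasAsymptoticExpansion (deriv ψ) b) : b 0 = 0 ∧ b 1 = 0 := by
  obtain ⟨C, R, h⟩ := hψ' 1
  have hψ_top : Tendsto ψ atTop (𝓝 (a 0)) :=
    hψ.tendsto_cobounded.mono_left (by rw [IsOrderBornology.cobounded_eq]; exact le_sup_right)
  have hdiff : Tendsto (fun x => ψ (2 * x) - ψ x) atTop (𝓝 0) := by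
    simpa using (hψ_top.comp (tendsto_id.const_mul_atTop (by norm_num : (0 : ℝ) < 2))).sub hψ_top
  have hbound : ∀ x, max R 1 ≤ x →
      ‖(ψ (2 * x) - ψ x) - (b 0 * x + b 1 * (Real.log 2 : ℝ))‖ ≤ C / x := by
    intro x hx
    have hxR : R ≤ x := (le_max_left _ _).trans hx
    have hx0 : 0 < x := lt_of_lt_of_le one_pos ((le_max_right _ _).trans hx)
    have hder : ∀ y ∈ Icc x (2 * x), HasDerivWithinAt
        (fun y : ℝ => ψ y - (b 0 * (y : ℂ) + b 1 * ((Real.log y : ℝ) : ℂ)))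
        (deriv ψ y - (b 0 * 1 + b 1 * ((y⁻¹ : ℝ) : ℂ))) (Icc x (2 * x)) y := by
      intro y hy
      have hy0 : y ≠ 0 := (hx0.trans_le hy.1).ne'
      exact ((hd y).hasDerivAt.sub (((hasDerivAt_id y).ofReal_comp.const_mul _).add
        ((Real.hasDerivAt_log hy0).ofReal_comp.const_mul _))).hasDerivWithinAt
    have hle : ∀ y ∈ Ico x (2 * x),
        ‖deriv ψ y - (b 0 * 1 + b 1 * ((y⁻¹ : ℝ) : ℂ))‖ ≤ C / x ^ 2 := by
      intro y hy
      have hy0 : 0 < y := hx0.trans_le hy.1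
      have := h y (by rw [abs_of_pos hy0]; exact hxR.trans hy.1)
      rw [abs_of_pos hy0] at this
      simp only [Finset.sum_range_succ, Finset.sum_range_zero, zero_add, pow_zero, pow_one,
        div_one, Nat.reduceAdd] at this
      rw [le_div_iff₀ (by positivity), mul_one, Complex.ofReal_inv, ← div_eq_mul_inv]
      refine le_trans ?_ this
      have := hy.1
      gcongr
    have := norm_image_sub_le_of_norm_deriv_le_segment' hder hle (2 * x)
      ⟨by linarith, le_rfl⟩
    rw [Real.log_mul two_ne_zero hx0.ne'] at this
    push_cast at this ⊢
    convert this using 1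
    · congr 1
      ring
    · field_simp
      ring
  have hlim : Tendsto (fun x : ℝ => b 0 * x + b 1 * (Real.log 2 : ℝ)) atTop (𝓝 0) := by
    have hrem : Tendsto
        (fun x : ℝ => (ψ (2 * x) - ψ x) - (b 0 * x + b 1 * (Real.log 2 : ℝ))) atTop (𝓝 0) := by
      refine squeeze_zero_norm' ?_ (tendsto_id.const_div_atTop C)
      filter_upwards [eventually_ge_atTop (max R 1)] with x hx using hbound x hx
    simpa using hdiff.sub hrem
  have hinv : Tendsto (fun x : ℝ => ((x⁻¹ : ℝ) : ℂ)) atTop (𝓝 0) := by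
    rw [← Complex.ofReal_zero]
    exact (Complex.continuous_ofReal.tendsto 0).comp tendsto_inv_atTop_zero
  have hb0 : b 0 = 0 := by
    have h1 : Tendsto (fun x : ℝ => (b 0 * x + b 1 * (Real.log 2 : ℝ)) * ((x⁻¹ : ℝ) : ℂ)
        - b 1 * (Real.log 2 : ℝ) * ((x⁻¹ : ℝ) : ℂ)) atTop (𝓝 0) := by
      simpa using (hlim.mul hinv).sub (hinv.const_mul (b 1 * (Real.log 2 : ℝ)))
    refine tendsto_nhds_unique (tendsto_const_nhds.congr' ?_) h1
    filter_upwards [eventually_ne_atTop 0] with x hx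
    have : (x : ℂ) ≠ 0 := Complex.ofReal_ne_zero.2 hx
    push_cast
    field_simp
    ring
  refine ⟨hb0, ?_⟩
  simp only [hb0, zero_mul, zero_add] at hlim
  have := tendsto_nhds_unique hlim tendsto_const_nhds
  have hlog : ((Real.log 2 : ℝ) : ℂ) ≠ 0 :=
    Complex.ofReal_ne_zero.2 (Real.log_pos one_lt_two).ne'
  exact (mul_eq_zero.1 this.symm).resolve_right hlog

end HasAsymptoticExpansion

/-- A smooth function which, together with all its derivatives, has an asymptotic expansion at
infinity. -/
def SmoothWithExpansions (φ : ℝ → ℂ) : Prop :=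
  ContDiff ℝ (⊤ : ℕ∞) φ ∧ ∀ n : ℕ, ∃ a : ℕ → ℂ, HasAsymptoticExpansion (iteratedDeriv n φ) a

theorem contDiff_top_deriv {φ : ℝ → ℂ} (hφ : ContDiff ℝ (⊤ : ℕ∞) φ) :
    ContDiff ℝ (⊤ : ℕ∞) (deriv φ) :=
  (contDiff_infty_iff_deriv.1 hφ).2

theorem differentiable_iteratedDeriv_of_contDiff_top {φ : ℝ → ℂ} (hφ : ContDiff ℝ (⊤ : ℕ∞) φ)
    (n : ℕ) : Differentiable ℝ (iteratedDeriv n φ) :=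
  hφ.differentiable_iteratedDeriv n (by exact_mod_cast WithTop.coe_lt_top _)

theorem iteratedDeriv_ofReal_mul {φ : ℝ → ℂ} (hφ : ContDiff ℝ (⊤ : ℕ∞) φ) (n : ℕ) :
    iteratedDeriv (n + 1) (fun x : ℝ => (x : ℂ) * φ x) = fun x : ℝ =>
      (x : ℂ) * iteratedDeriv (n + 1) φ x + (n + 1 : ℂ) * iteratedDeriv n φ x := by
  have hder : ∀ (m : ℕ) (x : ℝ), HasDerivAt (fun x : ℝ => (x : ℂ) * iteratedDeriv m φ x)
      (iteratedDeriv m φ x + x * iteratedDeriv (m + 1) φ x) x := by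
    intro m x
    have h := (hasDerivAt_id x).ofReal_comp.mul
      (differentiable_iteratedDeriv_of_contDiff_top hφ m x).hasDerivAt
    rw [← iteratedDeriv_succ] at h
    exact h.congr_deriv (by simp)
  induction n with
  | zero =>
    ext x
    have h := (hder 0 x).deriv
    simp only [iteratedDeriv_zero] at h
    rw [zero_add, iteratedDeriv_one, h]
    simp [add_comm]
  | succ n ih =>
    ext x
    rw [iteratedDeriv_succ, ih]
    have h := (hder (n + 1) x).add
      ((differentiable_iteratedDeriv_of_contDiff_top hφ n x).hasDerivAt.const_mul (n + 1 : ℂ))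
    rw [← iteratedDeriv_succ] at h
    refine h.deriv.trans ?_
    push_cast
    ring

namespace SmoothWithExpansions

variable {φ : ℝ → ℂ}

theorem deriv (hφ : SmoothWithExpansions φ) : SmoothWithExpansions (deriv φ) :=
  ⟨contDiff_top_deriv hφ.1, fun n => by
    rw [← iteratedDeriv_succ']
    exact hφ.2 (n + 1)⟩

theorem ofReal_mul (hφ : SmoothWithExpansions φ) {a : ℕ → ℂ} (ha : HasAsymptoticExpansion φ a)
    (h0 : a 0 = 0) : SmoothWithExpansions (fun x : ℝ => (x : ℂ) * φ x) := by
  refine ⟨Complex.ofRealCLM.contDiff.mul hφ.1, fun n => ?_⟩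
  cases n with
  | zero => exact ⟨_, by simpa using ha.ofReal_mul h0⟩
  | succ n =>
    obtain ⟨b, hb⟩ := hφ.2 n
    obtain ⟨c, hc⟩ := hφ.2 (n + 1)
    have hc0 : c 0 = 0 := by
      rw [iteratedDeriv_succ] at hc
      exact (hb.deriv_coeff_eq_zero
        (differentiable_iteratedDeriv_of_contDiff_top hφ.1 n) hc).1
    rw [iteratedDeriv_ofReal_mul hφ.1]
    exact ⟨_, (hc.ofReal_mul hc0).add (hb.const_mul _)⟩

theorem const_mul (c : ℂ) (hφ : SmoothWithExpansions φ) :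
    SmoothWithExpansions (fun x => c * φ x) := by
  refine ⟨contDiff_const.mul hφ.1, fun n => ?_⟩
  obtain ⟨a, ha⟩ := hφ.2 n
  refine ⟨fun m => c * a m, ?_⟩
  have h : iteratedDeriv n (fun x => c * φ x) = fun x => c * iteratedDeriv n φ x := by
    ext x
    exact iteratedDeriv_const_mul_field c φ
  rw [h]
  exact ha.const_mul c

/-- The derivative of `t ↦ φ (1 / t)` is `t ↦ ψ (1 / t)` with `ψ x = -x ^ 2 * φ' x`, and `ψ` is
again smooth with expansions. -/
theorem neg_sq_mul_deriv (hφ : SmoothWithExpansions φ) :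
    SmoothWithExpansions (fun x : ℝ => (-1) * ((x : ℂ) * ((x : ℂ) * _root_.deriv φ x))) := by
  obtain ⟨a, ha⟩ := hφ.2 0
  obtain ⟨b, hb⟩ := hφ.2 1
  rw [iteratedDeriv_zero] at ha
  rw [iteratedDeriv_one] at hb
  obtain ⟨hb0, hb1⟩ := ha.deriv_coeff_eq_zero (hφ.1.differentiable (by simp)) hb
  exact ((hφ.deriv.ofReal_mul hb hb0).ofReal_mul (hb.ofReal_mul hb0) hb1).const_mul (-1)

/-- The value at `0` is the limit of `φ` at infinity. -/
theorem exists_continuous_extension (hφ : SmoothWithExpansions φ) :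
    ∃ g : ℝ → ℂ, ContinuousAt g 0 ∧ ∀ x, x ≠ 0 → g x = φ x⁻¹ := by
  obtain ⟨a, ha⟩ := hφ.2 0
  rw [iteratedDeriv_zero] at ha
  refine ⟨Function.update (fun x => φ x⁻¹) 0 (a 0), ?_, fun x hx => Function.update_of_ne hx _ _⟩
  rw [continuousAt_update_same]
  exact ha.tendsto_cobounded.comp tendsto_inv₀_nhdsNE_zero

theorem contDiff_extension (n : ℕ) : ∀ {φ : ℝ → ℂ}, SmoothWithExpansions φ → ∀ {g : ℝ → ℂ},
    ContinuousAt g 0 → (∀ x, x ≠ 0 → g x = φ x⁻¹) → ContDiff ℝ n g := by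
  have hmain : ∀ {φ : ℝ → ℂ}, SmoothWithExpansions φ → ∀ {g : ℝ → ℂ},
      ContinuousAt g 0 → (∀ x, x ≠ 0 → g x = φ x⁻¹) → ∀ {g' : ℝ → ℂ}, ContinuousAt g' 0 →
      (∀ x, x ≠ 0 → g' x = (-1) * ((x⁻¹ : ℝ) * ((x⁻¹ : ℝ) * _root_.deriv φ x⁻¹))) →
      ∀ x, HasDerivAt g (g' x) x := by
    intro φ hφ g hg hgφ g' hg' hg'φ
    refine hasDerivAt_of_hasDerivAt_of_ne' (fun y hy => ?_) hg hg'
    have hd := (hφ.1.differentiable (by simp) y⁻¹).hasDerivAt.scomp y (hasDerivAt_inv hy)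
    have heq : g =ᶠ[𝓝 y] φ ∘ fun x => x⁻¹ := by
      filter_upwards [eventually_ne_nhds hy] with x hx using hgφ x hx
    refine (hd.congr_of_eventuallyEq heq).congr_deriv ?_
    rw [hg'φ y hy, Complex.real_smul]
    push_cast
    field_simp
  induction n with
  | zero =>
    intro φ hφ g hg hgφ
    obtain ⟨g', hg', hg'φ⟩ := hφ.neg_sq_mul_deriv.exists_continuous_extension
    exact contDiff_zero.2 (continuous_iff_continuousAt.2 fun x =>
      (hmain hφ hg hgφ hg' hg'φ x).continuousAt)
  | succ n ih =>
    intro φ hφ g hg hgφ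
    obtain ⟨g', hg', hg'φ⟩ := hφ.neg_sq_mul_deriv.exists_continuous_extension
    have hd := hmain hφ hg hgφ hg' hg'φ
    have hderiv : _root_.deriv g = g' := funext fun x => (hd x).deriv
    push_cast
    refine contDiff_succ_iff_deriv.2 ⟨fun x => (hd x).differentiableAt, by simp, ?_⟩
    rw [hderiv]
    exact ih hφ.neg_sq_mul_deriv hg' hg'φ

end SmoothWithExpansions

/-- The Taylor expansion of `g` at `0` gives the expansion of `x ↦ g (1 / x)` at infinity. -/
theorem hasAsymptoticExpansion_of_contDiff {φ g : ℝ → ℂ} (hg : ContDiff ℝ (⊤ : ℕ∞) g)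
    (hgφ : ∀ x, x ≠ 0 → g x = φ x⁻¹) :
    HasAsymptoticExpansion φ (fun m => ((m.factorial : ℂ))⁻¹ * iteratedDeriv m g 0) := by
  intro N
  have hO : (fun x => g x - taylorWithinEval g N univ 0 x) =O[𝓝 0] fun x => x ^ (N + 1) := by
    have h1 := (taylor_isLittleO_univ (x₀ := 0) (n := N + 1)
      (hg.of_le (by exact_mod_cast le_top))).isBigO
    have h2 : (fun x : ℝ => (((N + 1 : ℝ) * N.factorial)⁻¹ * (x - 0) ^ (N + 1)) •
        iteratedDerivWithin (N + 1) g univ 0) =O[𝓝 0] fun x => (x - 0) ^ (N + 1) := by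
      refine .of_bound (‖((N + 1 : ℝ) * N.factorial)⁻¹‖ *
        ‖iteratedDerivWithin (N + 1) g univ 0‖) (.of_forall fun x => le_of_eq ?_)
      rw [norm_smul, norm_mul]
      ring
    refine (h1.add h2).congr (fun x => ?_) (fun x => by rw [sub_zero])
    rw [taylorWithinEval_succ]
    abel
  obtain ⟨C, hC⟩ := hO.bound
  have hev : ∀ᶠ x in Bornology.cobounded ℝ, ‖g x⁻¹ - taylorWithinEval g N univ 0 x⁻¹‖ ≤
      C * ‖x⁻¹ ^ (N + 1)‖ := tendsto_inv₀_cobounded.eventually hC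
  obtain ⟨R, -, hR⟩ := (Filter.hasBasis_cobounded_norm.eventually_iff).1 hev
  refine ⟨C, max R 1, fun x hx => ?_⟩
  have hx1 : 1 ≤ |x| := (le_max_right _ _).trans hx
  have hx0 : x ≠ 0 := by
    rintro rfl
    norm_num at hx1
  have h := hR (show R ≤ ‖x‖ from (le_max_left _ _).trans hx)
  rw [hgφ _ (inv_ne_zero hx0), inv_inv, taylor_within_apply, norm_pow, norm_inv,
    Real.norm_eq_abs, inv_pow, ← div_eq_mul_inv, le_div_iff₀ (by positivity)] at h
  refine le_trans (le_of_eq ?_) h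
  congr 3
  refine Finset.sum_congr rfl fun m _ => ?_
  rw [iteratedDerivWithin_univ, Complex.real_smul]
  push_cast
  rw [sub_zero, inv_pow]
  ring

theorem exists_contDiff_extension_deriv {φ g : ℝ → ℂ} (hφ : ContDiff ℝ (⊤ : ℕ∞) φ)
    (hg : ContDiff ℝ (⊤ : ℕ∞) g) (hgφ : ∀ x, x ≠ 0 → g x = φ x⁻¹) :
    ∃ g' : ℝ → ℂ, ContDiff ℝ (⊤ : ℕ∞) g' ∧ ∀ x, x ≠ 0 → g' x = deriv φ x⁻¹ := by
  refine ⟨fun x => (-((x : ℂ) ^ 2)) * deriv g x,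
    (Complex.ofRealCLM.contDiff.pow 2).neg.mul (contDiff_top_deriv hg), fun x hx => ?_⟩
  have hd := (hφ.differentiable (by simp) x⁻¹).hasDerivAt.scomp x (hasDerivAt_inv hx)
  have heq : g =ᶠ[𝓝 x] φ ∘ fun x => x⁻¹ := by
    filter_upwards [eventually_ne_nhds hx] with y hy using hgφ y hy
  have hx' : (x : ℂ) ≠ 0 := Complex.ofReal_ne_zero.2 hx
  simp only [(hd.congr_of_eventuallyEq heq).deriv, Complex.real_smul]
  push_cast
  field_simp

theorem exists_contDiff_extension_iteratedDeriv {φ g : ℝ → ℂ} (hφ : ContDiff ℝ (⊤ : ℕ∞) φ)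
    (hg : ContDiff ℝ (⊤ : ℕ∞) g) (hgφ : ∀ x, x ≠ 0 → g x = φ x⁻¹) (n : ℕ) :
    ∃ g' : ℝ → ℂ, ContDiff ℝ (⊤ : ℕ∞) g' ∧ ∀ x, x ≠ 0 → g' x = iteratedDeriv n φ x⁻¹ := by
  induction n generalizing φ g with
  | zero => exact ⟨g, hg, by simpa using hgφ⟩
  | succ n ih =>
    obtain ⟨g', hg', hgφ'⟩ := exists_contDiff_extension_deriv hφ hg hgφ
    rw [iteratedDeriv_succ']
    exact ih (contDiff_top_deriv hφ) hg' hgφ'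

/-- for smooth `φ : ℝ → ℂ` with `γ(x) = φ(1/x)` for `x ≠ 0`: `φ` and all
its derivatives have asymptotic expansions at infinity iff `γ` extends to a smooth
function on `ℝ`. -/
theorem asymptotic_iff_smooth_at_zero (φ : ℝ → ℂ) (hφ : ContDiff ℝ (⊤ : ℕ∞) φ) :
    (∀ n : ℕ, ∃ a : ℕ → ℂ, HasAsymptoticExpansion (iteratedDeriv n φ) a) ↔
      ∃ g : ℝ → ℂ, ContDiff ℝ (⊤ : ℕ∞) g ∧ ∀ x : ℝ, x ≠ 0 → g x = φ (1 / x) := by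
  simp only [one_div]
  constructor
  · intro h
    have hφ' : SmoothWithExpansions φ := ⟨hφ, h⟩
    obtain ⟨g, hg, hgφ⟩ := hφ'.exists_continuous_extension
    exact ⟨g, contDiff_infty.2 fun n => hφ'.contDiff_extension n hg hgφ, hgφ⟩
  · rintro ⟨g, hg, hgφ⟩ n
    obtain ⟨g', hg', hgφ'⟩ := exists_contDiff_extension_iteratedDeriv hφ hg hgφ n
    exact ⟨_, hasAsymptoticExpansion_of_contDiff hg' hgφ'⟩
end
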